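/- arXiv:0804.0011 — 2 statements merged into one kernel-verified Lean document; each statement's English description precedes it below -/
import Mathlib

section
/- Let N ≥ 2 and let π₁,…,π_D be permutations of {1,…,N} with associated permutation matrices P(1),…,P(D). Suppose there is ε ∈ (0,1] such that ‖(1/D)∑_{s=1}^D P(s)⊗P(s) − |φ₁⟩⟨φ₁| − |φ₂⟩⟨φ₂|‖ ≤ 1 − ε (i.e. the permutations form an (N,D,1−ε,2) classical tensor product expander). Let Z := ∑_{j=1}^N e^{2πij/N} |j⟩⟨j| and p := 1/(1+ε). Then ‖(p/D)∑_{s=1}^D P(s)⊗P(s) + (1−p) Z⊗Z* − |φ₁⟩⟨φ₁|‖ ≤ 1 − ε/48, i.e. the quantum operation with Kraus operators √(p/D)P(1),…,√(p/D)P(D), √(1−p)Z is an (N,D+1,1−ε/48) quantum expander. -/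
open scoped Kronecker Matrix BigOperators

noncomputable section

/-- The ℓ₂→ℓ₂ operator norm (largest singular value) of a complex matrix. -/
def opNorm {n : Type*} [Fintype n] [DecidableEq n] (A : Matrix n n ℂ) : ℝ :=
  ‖Matrix.toEuclideanCLM (𝕜 := ℂ) A‖

/-- Permutation matrix: entry (i,j) is 1 iff π j = i. -/
def permMat (N : ℕ) (π : Equiv.Perm (Fin N)) : Matrix (Fin N) (Fin N) ℂ :=
  Matrix.of fun i j => if π j = i then 1 else 0

/-- The projection |φ₁⟩⟨φ₁| onto the maximally entangled state
φ₁ = (1/√N) ∑ᵢ eᵢ⊗eᵢ. -/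
def phi1Proj (N : ℕ) : Matrix (Fin N × Fin N) (Fin N × Fin N) ℂ :=
  Matrix.of fun p q => if p.1 = p.2 ∧ q.1 = q.2 then (N : ℂ)⁻¹ else 0

/-- The projection |φ₂⟩⟨φ₂| where φ₂ = (1/√(N(N-1))) ∑_{i≠j} eᵢ⊗eⱼ. -/
def phi2Proj (N : ℕ) : Matrix (Fin N × Fin N) (Fin N × Fin N) ℂ :=
  Matrix.of fun p q =>
    if p.1 ≠ p.2 ∧ q.1 ≠ q.2 then ((N : ℂ) * ((N : ℂ) - 1))⁻¹ else 0

/-- The diagonal phase matrix Z = ∑_{j=1}^N e^{2πij/N} |j⟩⟨j|. -/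
def Zmat (N : ℕ) : Matrix (Fin N) (Fin N) ℂ :=
  Matrix.diagonal fun j =>
    Complex.exp (((2 * Real.pi : ℝ) : ℂ) * Complex.I * (((j : ℕ) : ℂ) + 1) / (N : ℂ))

open scoped InnerProductSpace

section Hilbert

variable {E : Type*} [NormedAddCommGroup E] [InnerProductSpace ℂ E]

/-- The scalar inequality behind `norm_mix_le`. -/
lemma mix_sq_le {ε p α β n τ I : ℝ} (hε0 : 0 < ε) (hε1 : ε ≤ 1) (hp : p * (1 + ε) = 1)
    (hα : 0 ≤ α) (hβ : 0 ≤ β) (hn : 0 ≤ n) (hτ : 0 ≤ τ) (hnsq : n ^ 2 = α ^ 2 + β ^ 2)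
    (hτsq : τ ^ 2 ≤ α ^ 2 + ((1 - ε) * β) ^ 2) (hI : I ≤ 2 * (α * β) + β ^ 2)
    (hI' : I ≤ τ * n) :
    p ^ 2 * τ ^ 2 + (1 - p) ^ 2 * n ^ 2 + 2 * (p * (1 - p)) * I ≤ ((1 - ε / 48) * n) ^ 2 := by
  have hp0 : 1 / 2 ≤ p := by nlinarith
  have hp1 : p ≤ 1 := by nlinarith
  have hq : 1 - p = ε * p := by linarith
  have hpq : 0 ≤ p * (1 - p) := mul_nonneg (by linarith) (by linarith)
  rcases le_total (n ^ 2) (12 * β ^ 2) with h | h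
  · have hτn : τ ≤ (1 - ε / 24) * n := by
      refine abs_le_of_sq_le_sq' ?_ (mul_nonneg (by linarith) hn) |>.2
      have h1 : ε * β ^ 2 ≤ (2 * ε - ε ^ 2) * β ^ 2 :=
        mul_le_mul_of_nonneg_right (by nlinarith) (sq_nonneg β)
      have h2 : ε * n ^ 2 ≤ ε * (12 * β ^ 2) := mul_le_mul_of_nonneg_left h hε0.le
      nlinarith [sq_nonneg (ε * n)]
    have h1 : p * τ + (1 - p) * n ≤ (1 - ε / 48) * n := by
      have h2 : p * τ ≤ p * ((1 - ε / 24) * n) := mul_le_mul_of_nonneg_left hτn (by linarith)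
      have h3 : 0 ≤ (p - 1 / 2) * (ε * n) := mul_nonneg (by linarith) (by positivity)
      nlinarith
    have h0 : 0 ≤ p * τ + (1 - p) * n :=
      add_nonneg (mul_nonneg (by linarith) hτ) (mul_nonneg (by linarith) hn)
    calc _ ≤ p ^ 2 * τ ^ 2 + (1 - p) ^ 2 * n ^ 2 + 2 * (p * (1 - p)) * (τ * n) := by gcongr
      _ = (p * τ + (1 - p) * n) ^ 2 := by ring
      _ ≤ _ := pow_le_pow_left₀ h0 h1 2
  · have h1 : 33 * β ≤ 10 * α := by
      refine abs_le_of_sq_le_sq' ?_ (by positivity) |>.2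
      nlinarith
    have hI2 : I ≤ 2 / 3 * n ^ 2 := by nlinarith
    have hτn : τ ^ 2 ≤ n ^ 2 := by
      have : ((1 - ε) * β) ^ 2 ≤ β ^ 2 :=
        pow_le_pow_left₀ (mul_nonneg (by linarith) hβ) (by nlinarith) 2
      linarith
    have h2 : ε / 4 ≤ p * (1 - p) := by rw [hq]; nlinarith [mul_nonneg hε0.le (sub_nonneg.2 hp0)]
    calc _ ≤ p ^ 2 * n ^ 2 + (1 - p) ^ 2 * n ^ 2 + 2 * (p * (1 - p)) * (2 / 3 * n ^ 2) := by gcongr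
      _ = (1 - 2 / 3 * (p * (1 - p))) * n ^ 2 := by ring
      _ ≤ (1 - ε / 48) ^ 2 * n ^ 2 := by gcongr; nlinarith
      _ = _ := by ring

/-- If `R` is a strict contraction vanishing along the unit vector `f`, and `V` is a contraction
with `re ⟪f, V f⟫ ≤ 0`, then mixing `R + |f⟩⟨f|` with `V` yields a strict contraction. -/
lemma norm_mix_le {ε p : ℝ} (hε0 : 0 < ε) (hε1 : ε ≤ 1) (hp : p * (1 + ε) = 1)
    (R V : E →ₗ[ℂ] E) (f : E) (hf : ‖f‖ = 1) (hRf : R f = 0) (hfR : ∀ x, ⟪f, R x⟫_ℂ = 0)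
    (hR : ∀ x, ‖R x‖ ≤ (1 - ε) * ‖x‖) (hV : ∀ x, ‖V x‖ ≤ ‖x‖)
    (hfV : (⟪f, V f⟫_ℂ).re ≤ 0) (x : E) :
    ‖(p : ℂ) • (R x + ⟪f, x⟫_ℂ • f) + ((1 - p : ℝ) : ℂ) • V x‖ ≤ (1 - ε / 48) * ‖x‖ := by
  obtain ⟨a, ha⟩ : ∃ a, a = ⟪f, x⟫_ℂ := ⟨_, rfl⟩
  obtain ⟨y, hy⟩ : ∃ y, y = x - a • f := ⟨_, rfl⟩
  have hff : ⟪f, f⟫_ℂ = 1 := by rw [inner_self_eq_norm_sq_to_K, hf]; simp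
  have hfy : ⟪f, y⟫_ℂ = 0 := by rw [hy, inner_sub_right, inner_smul_right, hff, ← ha]; ring
  have hx : x = a • f + y := by rw [hy]; abel
  have hRx : R x = R y := by rw [hx, map_add, map_smul, hRf]; simp
  have hortho : ∀ z, ⟪f, z⟫_ℂ = 0 → ‖a • f + z‖ ^ 2 = ‖a‖ ^ 2 + ‖z‖ ^ 2 := by
    intro z hz
    have := norm_add_sq_eq_norm_sq_add_norm_sq_of_inner_eq_zero (𝕜 := ℂ) (a • f) z
      (by rw [inner_smul_left, hz, mul_zero])
    rw [norm_smul, hf, mul_one] at this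
    simpa [sq] using this
  obtain ⟨t, ht⟩ : ∃ t, t = a • f + R y := ⟨_, rfl⟩
  have hp0 : 0 ≤ p := by nlinarith
  have hnsq : ‖x‖ ^ 2 = ‖a‖ ^ 2 + ‖y‖ ^ 2 := by
    conv_lhs => rw [hx]
    exact hortho y hfy
  have hτsq : ‖t‖ ^ 2 ≤ ‖a‖ ^ 2 + ((1 - ε) * ‖y‖) ^ 2 := by
    rw [ht, hortho _ (hfR y)]
    gcongr
    exact hR y
  have hRy : ‖R y‖ ≤ ‖y‖ := (hR y).trans (by nlinarith [norm_nonneg y])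
  have hI' : (⟪t, V x⟫_ℂ).re ≤ ‖t‖ * ‖x‖ :=
    ((Complex.re_le_norm _).trans (norm_inner_le_norm _ _)).trans
      (mul_le_mul_of_nonneg_left (hV x) (norm_nonneg _))
  have hI : (⟪t, V x⟫_ℂ).re ≤ 2 * (‖a‖ * ‖y‖) + ‖y‖ ^ 2 := by
    have h0 : ⟪t, V x⟫_ℂ = (Complex.normSq a : ℂ) * ⟪f, V f⟫_ℂ + ⟪a • f, V y⟫_ℂ
        + ⟪R y, V (a • f)⟫_ℂ + ⟪R y, V y⟫_ℂ := by
      rw [ht, Complex.normSq_eq_conj_mul_self]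
      conv_lhs => rw [hx]
      simp only [map_add, map_smul, inner_add_left, inner_add_right, inner_smul_left,
        inner_smul_right]
      ring
    have key : ∀ u v : E, (⟪u, v⟫_ℂ).re ≤ ‖u‖ * ‖v‖ := fun u v =>
      (Complex.re_le_norm _).trans (norm_inner_le_norm _ _)
    have haf : ‖a • f‖ = ‖a‖ := by rw [norm_smul, hf, mul_one]
    have h1 : (⟪a • f, V y⟫_ℂ).re ≤ ‖a‖ * ‖y‖ :=
      (key _ _).trans (by rw [haf]; gcongr; exact hV y)
    have h2 : (⟪R y, V (a • f)⟫_ℂ).re ≤ ‖y‖ * ‖a‖ :=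
      (key _ _).trans (mul_le_mul hRy (haf ▸ hV _) (norm_nonneg _) (norm_nonneg _))
    have h3 : (⟪R y, V y⟫_ℂ).re ≤ ‖y‖ * ‖y‖ :=
      (key _ _).trans (mul_le_mul hRy (hV _) (norm_nonneg _) (norm_nonneg _))
    have h4 := mul_nonpos_of_nonneg_of_nonpos (Complex.normSq_nonneg a) hfV
    rw [h0, Complex.add_re, Complex.add_re, Complex.add_re, Complex.re_ofReal_mul]
    nlinarith
  have main := mix_sq_le hε0 hε1 hp (norm_nonneg a) (norm_nonneg y) (norm_nonneg x)
    (norm_nonneg t) hnsq hτsq hI hI'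
  have hsum : R x + ⟪f, x⟫_ℂ • f = t := by rw [hRx, ← ha, ht, add_comm]
  rw [hsum]
  refine abs_le_of_sq_le_sq' ?_ (mul_nonneg (by linarith) (norm_nonneg x)) |>.2
  refine le_trans ?_ main
  have hq0 : 0 ≤ 1 - p := by nlinarith
  rw [@norm_add_sq ℂ, norm_smul, norm_smul, inner_smul_left, inner_smul_right,
    Complex.norm_real, Complex.norm_real, Complex.conj_ofReal, Real.norm_of_nonneg hp0,
    Real.norm_of_nonneg hq0, RCLike.re_to_complex, Complex.re_ofReal_mul, Complex.re_ofReal_mul,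
    mul_pow, mul_pow]
  have : (1 - p) ^ 2 * ‖V x‖ ^ 2 ≤ (1 - p) ^ 2 * ‖x‖ ^ 2 := by gcongr; exact hV x
  linarith

/-- Removing from an isometry the projection onto a fixed unit vector leaves a contraction. -/
lemma norm_sub_inner_smul_le (U : E →ₗ[ℂ] E) (g : E) (hg : ‖g‖ = 1) (hU : ∀ x, ‖U x‖ = ‖x‖)
    (hUg : U g = g) (x : E) : ‖U x - ⟪g, x⟫_ℂ • g‖ ≤ ‖x‖ := by
  have h1 : U x - ⟪g, x⟫_ℂ • g = U (x - ⟪g, x⟫_ℂ • g) := by rw [map_sub, map_smul, hUg]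
  have hgg : ⟪g, g⟫_ℂ = 1 := by rw [inner_self_eq_norm_sq_to_K, hg]; simp
  have h2 : ⟪⟪g, x⟫_ℂ • g, x - ⟪g, x⟫_ℂ • g⟫_ℂ = 0 := by
    rw [inner_smul_left, inner_sub_right, inner_smul_right, hgg]; ring
  have h3 := norm_add_sq_eq_norm_sq_add_norm_sq_of_inner_eq_zero (𝕜 := ℂ) _ _ h2
  rw [add_sub_cancel] at h3
  rw [h1, hU]
  exact abs_le_of_sq_le_sq' (by nlinarith [mul_self_nonneg ‖⟪g, x⟫_ℂ • g‖]) (norm_nonneg _) |>.2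

end Hilbert

section Vectors

variable {N : ℕ}

/-- The vector `φ₁`. -/
def phi1Vec (N : ℕ) : Fin N × Fin N → ℂ :=
  fun p => if p.1 = p.2 then (((√(N : ℝ))⁻¹ : ℝ) : ℂ) else 0

/-- The vector `φ₂`. -/
def phi2Vec (N : ℕ) : Fin N × Fin N → ℂ :=
  fun p => if p.1 ≠ p.2 then (((√((N : ℝ) * (N - 1)))⁻¹ : ℝ) : ℂ) else 0

lemma ofReal_inv_sqrt_mul_self {r : ℝ} (hr : 0 ≤ r) :
    (((√r)⁻¹ : ℝ) : ℂ) * (((√r)⁻¹ : ℝ) : ℂ) = ((r : ℝ) : ℂ)⁻¹ := by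
  rw [← Complex.ofReal_mul, ← mul_inv, Real.mul_self_sqrt hr, Complex.ofReal_inv]

lemma natCast_mul_sub_one_pos (hN : 2 ≤ N) : 0 < (N : ℝ) * (N - 1) := by
  have : (2 : ℝ) ≤ N := by exact_mod_cast hN
  nlinarith

lemma phi1Proj_eq : phi1Proj N = Matrix.vecMulVec (phi1Vec N) (phi1Vec N) := by
  ext p q
  have := ofReal_inv_sqrt_mul_self (Nat.cast_nonneg (α := ℝ) N)
  rw [Complex.ofReal_natCast] at this
  by_cases h1 : p.1 = p.2 <;> by_cases h2 : q.1 = q.2 <;>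
    simp only [phi1Proj, Matrix.vecMulVec_apply, phi1Vec, h1, h2, Matrix.of_apply, if_true,
      if_false, and_self, and_true, and_false, mul_zero, zero_mul, this]

lemma phi2Proj_eq (hN : 2 ≤ N) :
    phi2Proj N = Matrix.vecMulVec (phi2Vec N) (phi2Vec N) := by
  ext p q
  have := ofReal_inv_sqrt_mul_self (natCast_mul_sub_one_pos hN).le
  rw [show (((N : ℝ) * (N - 1) : ℝ) : ℂ) = N * (N - 1) by push_cast; rfl] at this
  by_cases h1 : p.1 = p.2 <;> by_cases h2 : q.1 = q.2 <;>
    simp only [phi2Proj, Matrix.vecMulVec_apply, phi2Vec, h1, h2, Matrix.of_apply, this, ne_eq,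
      not_true, not_false_iff, if_true, if_false, and_self, and_true, and_false, mul_zero,
      zero_mul]

lemma sum_ne_mul (z w : Fin N → ℂ) :
    ∑ p : Fin N × Fin N, (if p.1 ≠ p.2 then z p.1 * w p.2 else 0)
      = (∑ i, z i) * (∑ i, w i) - ∑ i, z i * w i := by
  have h : ∀ p : Fin N × Fin N, (if p.1 ≠ p.2 then z p.1 * w p.2 else 0)
      = z p.1 * w p.2 - if p.1 = p.2 then z p.1 * w p.2 else 0 := by
    intro p; by_cases h : p.1 = p.2 <;> simp [h]
  rw [Finset.sum_congr rfl fun p _ => h p, Finset.sum_sub_distrib, Fintype.sum_prod_type,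
    Fintype.sum_prod_type, Finset.sum_mul_sum]
  simp

lemma star_phi1Vec : star (phi1Vec N) = phi1Vec N := by
  ext p; simp only [phi1Vec, Pi.star_apply]; split_ifs <;> simp

lemma star_phi2Vec : star (phi2Vec N) = phi2Vec N := by
  ext p; simp only [phi2Vec, Pi.star_apply]; split_ifs <;> simp

lemma phi1Vec_dotProduct_self (hN : 2 ≤ N) : phi1Vec N ⬝ᵥ phi1Vec N = 1 := by
  have := ofReal_inv_sqrt_mul_self (Nat.cast_nonneg (α := ℝ) N)
  have hN0 : (N : ℂ) ≠ 0 := by exact_mod_cast (by omega : N ≠ 0)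
  simp only [dotProduct, phi1Vec, ite_mul, zero_mul, mul_ite, mul_zero, Fintype.sum_prod_type,
    this]
  simp [hN0]

lemma phi1Vec_dotProduct_phi2Vec : phi1Vec N ⬝ᵥ phi2Vec N = 0 := by
  refine Finset.sum_eq_zero fun p _ => ?_
  by_cases h : p.1 = p.2 <;> simp [phi1Vec, phi2Vec, h]

lemma phi2Vec_dotProduct_diagonal (hN : 2 ≤ N) (z w : Fin N → ℂ) :
    phi2Vec N ⬝ᵥ (fun p => z p.1 * w p.2 * phi2Vec N p)
      = ((N : ℂ) * (N - 1))⁻¹ * ((∑ i, z i) * (∑ i, w i) - ∑ i, z i * w i) := by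
  have := ofReal_inv_sqrt_mul_self (natCast_mul_sub_one_pos hN).le
  push_cast at this
  rw [← sum_ne_mul, Finset.mul_sum]
  refine Finset.sum_congr rfl fun p _ => ?_
  by_cases h : p.1 = p.2
  · simp [phi2Vec, h]
  · simp only [phi2Vec, ne_eq, h, not_false_iff, if_true]
    push_cast
    rw [← this]
    ring

lemma phi2Vec_dotProduct_self (hN : 2 ≤ N) : phi2Vec N ⬝ᵥ phi2Vec N = 1 := by
  have h := phi2Vec_dotProduct_diagonal hN (fun _ => 1) (fun _ => 1)
  have h0 : (N : ℂ) * (N - 1) ≠ 0 := by exact_mod_cast (natCast_mul_sub_one_pos hN).ne'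
  simp only [one_mul] at h
  rw [show phi2Vec N = fun p => phi2Vec N p from rfl, h]
  simp only [Finset.sum_const, Finset.card_univ, Fintype.card_fin, nsmul_eq_mul, mul_one]
  rw [show (N : ℂ) * N - N = N * (N - 1) by ring, inv_mul_cancel₀ h0]

lemma phi1Vec_perm (π : Equiv.Perm (Fin N)) (i j : Fin N) :
    phi1Vec N (π i, π j) = phi1Vec N (i, j) := by
  simp [phi1Vec]

lemma phi2Vec_perm (π : Equiv.Perm (Fin N)) (i j : Fin N) :
    phi2Vec N (π i, π j) = phi2Vec N (i, j) := by
  simp [phi2Vec]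

lemma permMat_kronecker_mulVec (π : Equiv.Perm (Fin N)) (v : Fin N × Fin N → ℂ)
    (hv : ∀ i j, v (π i, π j) = v (i, j)) : (permMat N π ⊗ₖ permMat N π) *ᵥ v = v := by
  ext ⟨i, j⟩
  have h : ∀ k l, (permMat N π ⊗ₖ permMat N π) (i, j) (k, l) * v (k, l)
      = if k = π.symm i then (if l = π.symm j then v (k, l) else 0) else 0 := by
    intro k l
    simp only [Matrix.kroneckerMap_apply, permMat, Matrix.of_apply, Equiv.eq_symm_apply]
    split_ifs <;> simp
  simp only [Matrix.mulVec, dotProduct, Fintype.sum_prod_type, h]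
  simpa using (hv (π.symm i) (π.symm j)).symm

lemma vecMul_permMat_kronecker (π : Equiv.Perm (Fin N)) (v : Fin N × Fin N → ℂ)
    (hv : ∀ i j, v (π i, π j) = v (i, j)) : v ᵥ* (permMat N π ⊗ₖ permMat N π) = v := by
  ext ⟨i, j⟩
  have h : ∀ k l, v (k, l) * (permMat N π ⊗ₖ permMat N π) (k, l) (i, j)
      = if π i = k then (if π j = l then v (k, l) else 0) else 0 := by
    intro k l
    simp only [Matrix.kroneckerMap_apply, permMat, Matrix.of_apply]
    split_ifs <;> simp
  simp only [Matrix.vecMul, dotProduct, Fintype.sum_prod_type, h, Finset.sum_ite_eq,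
    Finset.sum_ite_irrel, Finset.sum_const_zero, Finset.mem_univ, if_true, hv]

lemma average_mulVec {D : ℕ} (hD : 1 ≤ D) (ps : Fin D → Equiv.Perm (Fin N))
    (v : Fin N × Fin N → ℂ) (hv : ∀ (π : Equiv.Perm (Fin N)) i j, v (π i, π j) = v (i, j)) :
    ((D : ℂ)⁻¹ • ∑ s, permMat N (ps s) ⊗ₖ permMat N (ps s)) *ᵥ v = v := by
  have hD0 : (D : ℂ) ≠ 0 := by exact_mod_cast (by omega : D ≠ 0)
  rw [Matrix.smul_mulVec, Matrix.sum_mulVec,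
    Finset.sum_congr rfl fun s _ => permMat_kronecker_mulVec (ps s) v (hv _)]
  rw [Finset.sum_const, Finset.card_univ, Fintype.card_fin, ← Nat.cast_smul_eq_nsmul ℂ,
    smul_smul, inv_mul_cancel₀ hD0, one_smul]

lemma vecMul_average {D : ℕ} (hD : 1 ≤ D) (ps : Fin D → Equiv.Perm (Fin N))
    (v : Fin N × Fin N → ℂ) (hv : ∀ (π : Equiv.Perm (Fin N)) i j, v (π i, π j) = v (i, j)) :
    v ᵥ* ((D : ℂ)⁻¹ • ∑ s, permMat N (ps s) ⊗ₖ permMat N (ps s)) = v := by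
  have hD0 : (D : ℂ) ≠ 0 := by exact_mod_cast (by omega : D ≠ 0)
  rw [Matrix.vecMul_smul, Matrix.vecMul_sum,
    Finset.sum_congr rfl fun s _ => vecMul_permMat_kronecker (ps s) v (hv _)]
  rw [Finset.sum_const, Finset.card_univ, Fintype.card_fin, ← Nat.cast_smul_eq_nsmul ℂ,
    smul_smul, inv_mul_cancel₀ hD0, one_smul]

/-- The diagonal entries of `Zmat N`. -/
def phase (N : ℕ) (j : Fin N) : ℂ :=
  Complex.exp (((2 * Real.pi : ℝ) : ℂ) * Complex.I * (((j : ℕ) : ℂ) + 1) / (N : ℂ))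

lemma norm_phase (j : Fin N) : ‖phase N j‖ = 1 := by
  have h : phase N j = Complex.exp ((2 * Real.pi * ((j : ℕ) + 1) / N : ℝ) * Complex.I) := by
    rw [phase]; congr 1; push_cast; ring
  rw [h, Complex.norm_exp_ofReal_mul_I]

lemma sum_phase (hN : 2 ≤ N) : ∑ j, phase N j = 0 := by
  have hζ := Complex.isPrimitiveRoot_exp N (by omega)
  have h : ∀ j : Fin N, phase N j = Complex.exp (2 * Real.pi * Complex.I / N)
      * Complex.exp (2 * Real.pi * Complex.I / N) ^ (j : ℕ) := by
    intro j
    rw [← Complex.exp_nat_mul, ← Complex.exp_add, phase]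
    congr 1; push_cast; ring
  rw [Finset.sum_congr rfl fun j _ => h j, ← Finset.mul_sum,
    Fin.sum_univ_eq_sum_range (fun i => Complex.exp (2 * Real.pi * Complex.I / N) ^ i),
    hζ.geom_sum_eq_zero (by omega), mul_zero]

lemma phase_mul_conj (j : Fin N) : phase N j * (starRingEnd ℂ) (phase N j) = 1 := by
  rw [Complex.mul_conj, Complex.normSq_eq_norm_sq, norm_phase]; simp

lemma Zmat_kronecker_conj_mulVec (v : Fin N × Fin N → ℂ) :
    (Zmat N ⊗ₖ (Zmat N).map (starRingEnd ℂ)) *ᵥ v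
      = fun p => phase N p.1 * (starRingEnd ℂ) (phase N p.2) * v p := by
  have h : Zmat N = Matrix.diagonal (phase N) := rfl
  ext p
  rw [h, Matrix.diagonal_map (map_zero _), Matrix.diagonal_kronecker_diagonal,
    Matrix.mulVec_diagonal]

end Vectors

lemma toEuclideanCLM_vecMulVec {n : Type*} [Fintype n] [DecidableEq n] (v : n → ℂ)
    (hv : star v = v) (x : EuclideanSpace ℂ n) :
    Matrix.toEuclideanCLM (𝕜 := ℂ) (Matrix.vecMulVec v v) x
      = ⟪WithLp.toLp 2 v, x⟫_ℂ • WithLp.toLp 2 v := by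
  ext i
  simp only [Matrix.ofLp_toEuclideanCLM, Matrix.vecMulVec_mulVec,
    EuclideanSpace.inner_eq_star_dotProduct, hv]
  simp [dotProduct_comm, mul_comm]

lemma norm_toLp_eq_one {n : Type*} [Fintype n] (v : n → ℂ) (hv : star v = v)
    (h : v ⬝ᵥ v = 1) : ‖WithLp.toLp 2 v‖ = 1 := by
  have h1 : ⟪WithLp.toLp 2 v, WithLp.toLp 2 v⟫_ℂ = 1 := by
    rw [EuclideanSpace.inner_toLp_toLp, hv, h]
  have h2 := inner_self_eq_norm_sq (𝕜 := ℂ) (WithLp.toLp 2 v)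
  rw [h1, RCLike.one_re] at h2
  exact (pow_eq_one_iff_of_nonneg (norm_nonneg _) two_ne_zero).1 h2.symm

/-- A classical 2-copy tensor product expander with gap ε, augmented by the phase
matrix Z with weight 1-p where p = 1/(1+ε), is a quantum expander with gap ε/48. -/
theorem stmt0 (N D : ℕ) (hN : 2 ≤ N) (hD : 1 ≤ D)
    (ps : Fin D → Equiv.Perm (Fin N)) (ε : ℝ) (hε0 : 0 < ε) (hε1 : ε ≤ 1)
    (hTPE : opNorm ((D : ℂ)⁻¹ • ∑ s, permMat N (ps s) ⊗ₖ permMat N (ps s)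
        - phi1Proj N - phi2Proj N) ≤ 1 - ε) :
    opNorm ((((1 / (1 + ε) : ℝ) : ℂ) / (D : ℂ)) •
        ∑ s, permMat N (ps s) ⊗ₖ permMat N (ps s)
      + ((1 - 1 / (1 + ε) : ℝ) : ℂ) • (Zmat N ⊗ₖ (Zmat N).map (starRingEnd ℂ))
      - phi1Proj N) ≤ 1 - ε / 48 := by
  obtain ⟨p, hp⟩ : ∃ p : ℝ, p = 1 / (1 + ε) := ⟨_, rfl⟩
  have hp1 : p * (1 + ε) = 1 := by rw [hp]; field_simp
  have hT1 := average_mulVec hD ps _ (phi2Vec_perm (N := N))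
  have hT2 := vecMul_average hD ps _ (phi2Vec_perm (N := N))
  rw [← hp, div_eq_mul_inv, mul_smul]
  obtain ⟨T, hT⟩ : ∃ T, T = (D : ℂ)⁻¹ • ∑ s, permMat N (ps s) ⊗ₖ permMat N (ps s) := ⟨_, rfl⟩
  obtain ⟨U, hU⟩ : ∃ U, U = Zmat N ⊗ₖ (Zmat N).map (starRingEnd ℂ) := ⟨_, rfl⟩
  obtain ⟨R, hR⟩ : ∃ R, R = T - phi1Proj N - phi2Proj N := ⟨_, rfl⟩
  rw [← hT] at hT1 hT2 hTPE ⊢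
  rw [← hU]
  rw [← hR] at hTPE
  have hsplit : (p : ℂ) • T + ((1 - p : ℝ) : ℂ) • U - phi1Proj N
      = (p : ℂ) • (R + phi2Proj N) + ((1 - p : ℝ) : ℂ) • (U - phi1Proj N) := by
    rw [hR]; push_cast; module
  have h12 : phi1Vec N ⬝ᵥ phi2Vec N = 0 := phi1Vec_dotProduct_phi2Vec
  have h22 : phi2Vec N ⬝ᵥ phi2Vec N = 1 := phi2Vec_dotProduct_self hN
  have hRf : R *ᵥ phi2Vec N = 0 := by
    rw [hR, phi1Proj_eq, phi2Proj_eq hN, Matrix.sub_mulVec, Matrix.sub_mulVec, hT1,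
      Matrix.vecMulVec_mulVec, Matrix.vecMulVec_mulVec, h12, h22]
    simp
  have hfR : phi2Vec N ᵥ* R = 0 := by
    rw [hR, phi1Proj_eq, phi2Proj_eq hN, Matrix.vecMul_sub, Matrix.vecMul_sub, hT2,
      Matrix.vecMul_vecMulVec, Matrix.vecMul_vecMulVec, dotProduct_comm, h12, h22]
    simp
  have hUg : U *ᵥ phi1Vec N = phi1Vec N := by
    rw [hU, Zmat_kronecker_conj_mulVec]
    ext q
    by_cases h : q.1 = q.2
    · rw [h, phase_mul_conj, one_mul]
    · simp [phi1Vec, h]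
  have hUnorm : ∀ x, ‖Matrix.toEuclideanCLM (𝕜 := ℂ) U x‖ = ‖x‖ := by
    intro x
    rw [EuclideanSpace.norm_eq, EuclideanSpace.norm_eq]
    simp only [Matrix.ofLp_toEuclideanCLM, hU, Zmat_kronecker_conj_mulVec]
    simp [norm_phase]
  have hV : ∀ x, Matrix.toEuclideanCLM (𝕜 := ℂ) (U - phi1Proj N) x
      = Matrix.toEuclideanCLM (𝕜 := ℂ) U x
        - ⟪WithLp.toLp 2 (phi1Vec N), x⟫_ℂ • WithLp.toLp 2 (phi1Vec N) := by
    intro x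
    rw [map_sub, phi1Proj_eq, sub_apply,
      toEuclideanCLM_vecMulVec _ star_phi1Vec]
  have hfUf : phi2Vec N ⬝ᵥ (U *ᵥ phi2Vec N) = -((N : ℂ) - 1)⁻¹ := by
    have hN0 : (N : ℂ) ≠ 0 := by exact_mod_cast (by omega : N ≠ 0)
    rw [hU, Zmat_kronecker_conj_mulVec,
      phi2Vec_dotProduct_diagonal hN (phase N) (fun i => (starRingEnd ℂ) (phase N i)),
      sum_phase hN]
    simp [phase_mul_conj, hN0]
  rw [hsplit, opNorm]
  refine ContinuousLinearMap.opNorm_le_bound _ (by linarith) fun x => ?_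
  have main := norm_mix_le hε0 hε1 hp1 (Matrix.toEuclideanCLM (𝕜 := ℂ) R).toLinearMap
    (Matrix.toEuclideanCLM (𝕜 := ℂ) (U - phi1Proj N)).toLinearMap (WithLp.toLp 2 (phi2Vec N))
    (norm_toLp_eq_one _ star_phi2Vec h22)
    (by simp [Matrix.toEuclideanCLM_toLp, hRf])
    (fun y => by
      rw [EuclideanSpace.inner_eq_star_dotProduct, dotProduct_comm]
      simp [star_phi2Vec, Matrix.ofLp_toEuclideanCLM, Matrix.dotProduct_mulVec, hfR])
    (fun y => (ContinuousLinearMap.le_opNorm _ y).trans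
      (mul_le_mul_of_nonneg_right hTPE (norm_nonneg y)))
    (fun y => by
      rw [ContinuousLinearMap.coe_coe, hV]
      exact norm_sub_inner_smul_le (Matrix.toEuclideanCLM (𝕜 := ℂ) U).toLinearMap _
        (norm_toLp_eq_one _ star_phi1Vec (phi1Vec_dotProduct_self hN)) hUnorm
        (by simp [Matrix.toEuclideanCLM_toLp, hUg]) y)
    (by
      rw [ContinuousLinearMap.coe_coe, hV, Matrix.toEuclideanCLM_toLp,
        EuclideanSpace.inner_toLp_toLp (phi1Vec N), star_phi1Vec, dotProduct_comm (phi2Vec N),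
        h12, zero_smul, sub_zero,
        EuclideanSpace.inner_toLp_toLp, star_phi2Vec, dotProduct_comm, hfUf]
      have : (2 : ℝ) ≤ N := by exact_mod_cast hN
      rw [show -((N : ℂ) - 1)⁻¹ = ((-((N : ℝ) - 1)⁻¹ : ℝ) : ℂ) by push_cast; rfl,
        Complex.ofReal_re]
      exact neg_nonpos.2 (inv_nonneg.2 (by linarith))) x
  refine le_trans (le_of_eq (congrArg norm ?_)) main
  rw [map_add, map_smul, map_smul, map_add, phi2Proj_eq hN]
  simp only [add_apply, smul_apply,
    toEuclideanCLM_vecMulVec _ star_phi2Vec, ContinuousLinearMap.coe_coe]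

end
end

section
/- For every even D ≥ 4 there exists a constant C > 0 (depending only on D) with the following property. Let N ≥ 3, k ≥ 1, let π₁,…,π_{D/2} be drawn independently and uniformly at random from the symmetric group S_N, and set π_{s+D/2} := π_s^{-1} for 1 ≤ s ≤ D/2. Let λ := ‖L_k − Π_k‖, where L_k := (1/D)∑_{s=1}^D P_{π_s}^{⊗k} and Π_k := (1/N!)∑_{π∈S_N} P_π^{⊗k} (so λ is the largest magnitude of an eigenvalue of L_k outside the common unit eigenspace). Then for every c > 1, Pr[ λ ≥ c·( λ_H^{1/(k+1)} + C·(log k + log log N)/log N ) ] ≤ c^{−(k+1)·log N / log(1/λ_H)}, where λ_H := 2√(D−1)/D. -/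
open scoped Kronecker Matrix BigOperators

noncomputable section

/-- The k-fold Kronecker tensor power of a matrix. -/
def tensorPow {n : Type*} [Fintype n] (A : Matrix n n ℂ) (k : ℕ) :
    Matrix (Fin k → n) (Fin k → n) ℂ :=
  Matrix.of fun i j => ∏ a, A (i a) (j a)

/-- λ_H = 2√(D-1)/D, the Ramanujan value. -/
def lamH (D : ℕ) : ℝ := 2 * Real.sqrt ((D : ℝ) - 1) / D

/-- L_k = (1/D) ∑_{s=1}^D P_{π_s}^{⊗k}, where the first D/2 permutations are
given and the second half are their inverses (indexed by `Fin (D/2) × Bool`). -/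
def LkHalf (N D k : ℕ) (πs : Fin (D / 2) → Equiv.Perm (Fin N)) :
    Matrix (Fin k → Fin N) (Fin k → Fin N) ℂ :=
  (D : ℂ)⁻¹ • ∑ p : Fin (D / 2) × Bool,
    tensorPow (if p.2 then permMat N (πs p.1)⁻¹ else permMat N (πs p.1)) k

/-- Π_k = (1/N!) ∑_{π ∈ S_N} P_π^{⊗k}, the projection onto the common fixed space. -/
def Pik (N k : ℕ) : Matrix (Fin k → Fin N) (Fin k → Fin N) ℂ :=
  ((N.factorial : ℂ))⁻¹ • ∑ π : Equiv.Perm (Fin N), tensorPow (permMat N π) k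

namespace PermWalk

section Exposure

variable {α V : Type*}

/-- The formal inverse of a letter. -/
def flip (a : α × Bool) : α × Bool := (a.1, !a.2)

@[simp] lemma flip_flip (a : α × Bool) : flip (flip a) = a := by simp [flip]

lemma flip_ne (a : α × Bool) : flip a ≠ a := by
  rcases a with ⟨a, b⟩; cases b <;> simp [flip]

/-- The permutation by which a letter acts. -/
def act (π : α → Equiv.Perm V) (a : α × Bool) : Equiv.Perm V :=
  if a.2 then (π a.1)⁻¹ else π a.1

lemma act_flip (π : α → Equiv.Perm V) (a : α × Bool) : act π (flip a) = (act π a)⁻¹ := by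
  rcases a with ⟨a, b⟩; cases b <;> simp [flip, act]

lemma eq_flip_or_eq_of_fst_eq {a b : α × Bool} (h : a.1 = b.1) : a = b ∨ a = flip b := by
  rcases a with ⟨a, x⟩; rcases b with ⟨b, y⟩
  cases x <;> cases y <;> simp_all [flip]

variable [DecidableEq α]

/-- Post-compose the permutation attached to the letter `a` with `σ`. -/
def postcomp (π : α → Equiv.Perm V) (a : α × Bool) (σ : Equiv.Perm V) : α → Equiv.Perm V :=
  Function.update π a.1 (if a.2 then π a.1 * σ⁻¹ else σ * π a.1)

lemma act_postcomp (π : α → Equiv.Perm V) (a : α × Bool) (σ : Equiv.Perm V) :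
    act (postcomp π a σ) a = σ * act π a := by
  rcases a with ⟨a, b⟩; cases b <;> simp [act, postcomp]

lemma act_postcomp_of_ne (π : α → Equiv.Perm V) {a b : α × Bool} (σ : Equiv.Perm V)
    (h : b.1 ≠ a.1) : act (postcomp π a σ) b = act π b := by
  simp [act, postcomp, Function.update_of_ne h]

lemma postcomp_injective (a : α × Bool) (σ : Equiv.Perm V) :
    Function.Injective fun π : α → Equiv.Perm V => postcomp π a σ := by
  intro π π' h
  funext i
  by_cases hi : i = a.1
  · subst hi
    have := congrFun h a.1
    simp only [postcomp, Function.update_self] at this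
    split_ifs at this <;> simpa using this
  · simpa [postcomp, Function.update_of_ne hi] using congrFun h i

variable [Fintype α] [Fintype V] [DecidableEq V]

/-- Conditioned on the values of some queries, a fresh query is nearly uniform. -/
lemma card_fresh_le {ι : Type*} (J : Finset ι) (a : ι → α × Bool) (s t : ι → V)
    (l : α × Bool) (u : V)
    (hfresh : ∀ j ∈ J, ¬(a j = l ∧ s j = u) ∧ ¬(flip (a j) = l ∧ t j = u)) (b : V) :
    (Fintype.card V - J.card) *
        (Finset.univ.filter fun π : α → Equiv.Perm V =>
          (∀ j ∈ J, act π (a j) (s j) = t j) ∧ act π l u = b).card ≤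
      (Finset.univ.filter fun π : α → Equiv.Perm V =>
          ∀ j ∈ J, act π (a j) (s j) = t j).card := by
  classical
  set Ω := Finset.univ.filter fun π : α → Equiv.Perm V => ∀ j ∈ J, act π (a j) (s j) = t j
  set O : Finset V := (J.filter fun j => a j = l).image t ∪
    (J.filter fun j => flip (a j) = l).image s with hO
  have hOcard : O.card ≤ J.card := by
    refine (Finset.card_union_le _ _).trans ?_
    refine (add_le_add Finset.card_image_le Finset.card_image_le).trans ?_
    rw [← Finset.card_union_of_disjoint]
    · exact Finset.card_le_card (Finset.union_subset (Finset.filter_subset _ _)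
        (Finset.filter_subset _ _))
    · rw [Finset.disjoint_filter]
      intro j _ h1 h2
      exact flip_ne (a j) (h2.trans h1.symm)
  have hmem : ∀ v, v ∉ O → ∀ j ∈ J, (a j = l → t j ≠ v) ∧ (flip (a j) = l → s j ≠ v) := by
    intro v hv j hj
    simp only [hO, Finset.mem_union, Finset.mem_image, Finset.mem_filter, not_or, not_exists] at hv
    exact ⟨fun h1 h2 => hv.1 j ⟨⟨hj, h1⟩, h2⟩, fun h1 h2 => hv.2 j ⟨⟨hj, h1⟩, h2⟩⟩
  have hsub : ∀ v ∈ Oᶜ, (Finset.univ.filter fun π : α → Equiv.Perm V =>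
      (∀ j ∈ J, act π (a j) (s j) = t j) ∧ act π l u = b).card ≤
      (Ω.filter fun π => act π l u = v).card := by
    intro v hv
    rw [Finset.mem_compl] at hv
    refine Finset.card_le_card_of_injOn (fun π => postcomp π l (Equiv.swap b v)) ?_
      (postcomp_injective _ _).injOn
    intro π hπ
    simp only [Finset.coe_filter, Finset.mem_univ, true_and, Set.mem_ofPred_eq] at hπ
    obtain ⟨hπ, hb⟩ := hπ
    simp only [Ω, Finset.coe_filter, Finset.mem_filter, Finset.mem_univ, true_and,
      Set.mem_ofPred_eq]
    refine ⟨fun j hj => ?_, by simp [act_postcomp, hb]⟩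
    by_cases h1 : (a j).1 = l.1
    · rcases eq_flip_or_eq_of_fst_eq h1 with h | h
      · have htb : t j ≠ b := by
          intro htb
          refine (hfresh j hj).1 ⟨h, ?_⟩
          have := hπ j hj
          rw [h, htb, ← hb] at this
          exact (act π l).injective this
        have htv := (hmem v hv j hj).1 h
        have := hπ j hj
        rw [h] at this ⊢
        rw [act_postcomp, Equiv.Perm.mul_apply, this, Equiv.swap_apply_of_ne_of_ne htb htv]
      · have hl : flip (a j) = l := by rw [h, flip_flip]
        have hst : act π l (t j) = s j := by
          have := hπ j hj
          rw [h, act_flip, Equiv.Perm.inv_eq_iff_eq] at this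
          exact this.symm
        have hsb : s j ≠ b := by
          intro hsb
          refine (hfresh j hj).2 ⟨hl, ?_⟩
          rw [hsb, ← hb] at hst
          exact (act π l).injective hst
        have hsv := (hmem v hv j hj).2 hl
        rw [h, act_flip, act_postcomp, Equiv.Perm.inv_eq_iff_eq, Equiv.Perm.mul_apply, hst,
          Equiv.swap_apply_of_ne_of_ne hsb hsv]
    · rw [act_postcomp_of_ne _ _ h1]
      exact hπ j hj
  calc _ ≤ Oᶜ.card * _ := by
        refine Nat.mul_le_mul_right _ ?_
        rw [Finset.card_compl]; omega
    _ ≤ ∑ v ∈ Oᶜ, (Ω.filter fun π => act π l u = v).card := by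
        rw [← smul_eq_mul]; exact Finset.card_nsmul_le_sum _ _ _ hsub
    _ ≤ ∑ v, (Ω.filter fun π => act π l u = v).card :=
        Finset.sum_le_sum_of_subset (Finset.subset_univ _)
    _ = Ω.card := (Finset.card_eq_sum_card_fiberwise (fun _ _ => Finset.mem_univ _)).symm

end Exposure

/-- A product of adapted weights whose conditional averages are bounded by `ρ i` has average at
most `∏ ρ i`. -/
lemma sum_prod_weight_le {Ω V : Type*} [Fintype Ω] [Fintype V] [DecidableEq V]
    (q : ℕ → Ω → V) (W : ℕ → Ω → ℝ) (ρ : ℕ → ℝ) (hW0 : ∀ i π, 0 ≤ W i π) (hρ : ∀ i, 0 ≤ ρ i)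
    (hdep : ∀ i π π', (∀ j ≤ i, q j π = q j π') → W i π = W i π') (n : ℕ)
    (hstep : ∀ i < n, ∀ π', ∑ π with ∀ j < i, q j π = q j π', W i π ≤
      ρ i * (Finset.univ.filter fun π => ∀ j < i, q j π = q j π').card) :
    ∑ π, ∏ i ∈ Finset.range n, W i π ≤ (∏ i ∈ Finset.range n, ρ i) * Fintype.card Ω := by
  induction n with
  | zero => simp
  | succ n ih =>
    have ih := ih fun i hi => hstep i (by omega)
    let κ : Ω → (Fin n → V) := fun π j => q j π
    have hκ : ∀ π π', κ π = κ π' ↔ ∀ j < n, q j π = q j π' := by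
      intro π π'
      refine ⟨fun h j hj => congrFun h ⟨j, hj⟩, fun h => funext fun j => h j j.2⟩
    have hF : ∀ π π', κ π = κ π' →
        ∏ i ∈ Finset.range n, W i π = ∏ i ∈ Finset.range n, W i π' := by
      intro π π' h
      rw [hκ] at h
      refine Finset.prod_congr rfl fun i hi => hdep i _ _ fun j hj => h j ?_
      have := Finset.mem_range.1 hi
      omega
    have key : ∑ π, (∏ i ∈ Finset.range n, W i π) * W n π ≤
        ∑ π, (∏ i ∈ Finset.range n, W i π) * ρ n := by
      rw [← Finset.sum_fiberwise Finset.univ κ, ← Finset.sum_fiberwise Finset.univ κ]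
      refine Finset.sum_le_sum fun h _ => ?_
      by_cases hne : ∃ π', κ π' = h
      · obtain ⟨π', rfl⟩ := hne
        have e1 : ∀ g : Ω → ℝ, ∑ π with κ π = κ π', (∏ i ∈ Finset.range n, W i π) * g π =
            (∏ i ∈ Finset.range n, W i π') * ∑ π with κ π = κ π', g π := by
          intro g
          rw [Finset.mul_sum]
          refine Finset.sum_congr rfl fun π hπ => ?_
          rw [hF π π' (Finset.mem_filter.1 hπ).2]
        rw [e1, e1]
        refine mul_le_mul_of_nonneg_left ?_ (Finset.prod_nonneg fun i _ => hW0 i _)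
        have := hstep n (by omega) π'
        simp only [hκ, Finset.sum_const, nsmul_eq_mul]
        linarith
      · push Not at hne
        rw [Finset.filter_false_of_mem fun π _ => hne π]
        simp
    calc _ = ∑ π, (∏ i ∈ Finset.range n, W i π) * W n π := by simp only [Finset.prod_range_succ]
      _ ≤ (∑ π, ∏ i ∈ Finset.range n, W i π) * ρ n := by rw [Finset.sum_mul]; exact key
      _ ≤ _ := mul_le_mul_of_nonneg_right ih (hρ n)
      _ = _ := by rw [Finset.prod_range_succ]; ring

section Trajectory

variable {α V : Type*}

/-- The source of the `i`-th query: either a prescribed restart point `src i`, or the result of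
the previous query. -/
def pos (src : ℕ → Option V) (v : V) (c : ℕ → α × Bool) (π : α → Equiv.Perm V) : ℕ → V
  | 0 => v
  | i + 1 => (src (i + 1)).getD (act π (c i) (pos src v c π i))

/-- The result of the `i`-th query. -/
def tgt (src : ℕ → Option V) (v : V) (c : ℕ → α × Bool) (π : α → Equiv.Perm V) (i : ℕ) : V :=
  act π (c i) (pos src v c π i)

/-- The `i`-th query is not determined by the earlier ones. -/
def Fresh (src : ℕ → Option V) (v : V) (c : ℕ → α × Bool) (π : α → Equiv.Perm V) (i : ℕ) : Prop :=
  ∀ j < i, ¬(c j = c i ∧ pos src v c π j = pos src v c π i) ∧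
    ¬(flip (c j) = c i ∧ tgt src v c π j = pos src v c π i)

variable (src : ℕ → Option V) (v : V) (c : ℕ → α × Bool)

lemma pos_congr {π π' : α → Equiv.Perm V} {i : ℕ}
    (h : ∀ j < i, tgt src v c π j = tgt src v c π' j) :
    ∀ j ≤ i, pos src v c π j = pos src v c π' j := by
  intro j hj
  cases j with
  | zero => rfl
  | succ j =>
    have := h j (by omega)
    simp only [tgt] at this
    simp only [pos, this]

lemma fresh_congr {π π' : α → Equiv.Perm V} {i : ℕ}
    (h : ∀ j < i, tgt src v c π j = tgt src v c π' j) :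
    Fresh src v c π i ↔ Fresh src v c π' i := by
  refine forall₂_congr fun j hj => ?_
  rw [pos_congr src v c h j hj.le, pos_congr src v c h i le_rfl, h j hj]

lemma forall_tgt_eq_iff (π π' : α → Equiv.Perm V) (i : ℕ) :
    (∀ j < i, tgt src v c π j = tgt src v c π' j) ↔
      ∀ j ∈ Finset.range i, act π (c j) (pos src v c π' j) = tgt src v c π' j := by
  constructor
  · intro h j hj
    have hj := Finset.mem_range.1 hj
    rw [← pos_congr src v c h j hj.le]
    exact h j hj
  · intro h j
    induction j using Nat.strong_induction_on with
    | _ j ih =>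
      intro hj
      have hp := pos_congr src v c (fun k hk => ih k hk (hk.trans hj)) j le_rfl
      rw [← h j (Finset.mem_range.2 hj), ← hp, tgt]

variable [Fintype α] [DecidableEq α] [Fintype V] [DecidableEq V]

lemma card_tgt_eq_le {π' : α → Equiv.Perm V} {i : ℕ} (hf : Fresh src v c π' i) (b : V) :
    (Fintype.card V - i) *
      (Finset.univ.filter fun π => (∀ j < i, tgt src v c π j = tgt src v c π' j) ∧
        tgt src v c π i = b).card ≤
      (Finset.univ.filter fun π => ∀ j < i, tgt src v c π j = tgt src v c π' j).card := by
  have := card_fresh_le (V := V) (Finset.range i) c (pos src v c π') (tgt src v c π') (c i)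
    (pos src v c π' i) (fun j hj => hf j (Finset.mem_range.1 hj)) b
  rw [Finset.card_range] at this
  convert! this using 3
  · ext π
    simp only [Finset.mem_filter, Finset.mem_univ, true_and, ← forall_tgt_eq_iff]
    refine and_congr_right fun h => ?_
    rw [tgt, pos_congr src v c h i le_rfl]
  · rw [forall_tgt_eq_iff]

lemma card_tgt_eq_le_div {π' : α → Equiv.Perm V} {i K : ℕ} (hf : Fresh src v c π' i) (hi : i ≤ K)
    (hK : K < Fintype.card V) (b : V) :
    ((Finset.univ.filter fun π => (∀ j < i, tgt src v c π j = tgt src v c π' j) ∧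
        tgt src v c π i = b).card : ℝ) ≤
      ((Fintype.card V : ℝ) - K)⁻¹ *
      (Finset.univ.filter fun π => ∀ j < i, tgt src v c π j = tgt src v c π' j).card := by
  have h := card_tgt_eq_le src v c hf b
  have h2 : ((Fintype.card V - K : ℕ) : ℝ) = (Fintype.card V : ℝ) - K := Nat.cast_sub hK.le
  rw [← h2, inv_mul_eq_div, le_div_iff₀ (by exact_mod_cast Nat.sub_pos_of_lt hK)]
  norm_cast
  rw [mul_comm]
  exact (Nat.mul_le_mul_right _ (by omega)).trans h

open Classical in
/-- Number of fresh queries among the first `n` that hit an already visited point. -/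
def coincidences (S : Finset V) (n : ℕ) (π : α → Equiv.Perm V) : ℕ :=
  ((Finset.range n).filter fun i => Fresh src v c π i ∧
    tgt src v c π i ∈ S ∪ (Finset.range i).image (tgt src v c π)).card

lemma sum_pow_coincidences_le (S : Finset V) {n K : ℕ} (hn : n + S.card ≤ K)
    (hK : K < Fintype.card V) {z : ℝ} (hz : 1 ≤ z) :
    ∑ π : α → Equiv.Perm V, z ^ coincidences src v c S n π ≤
      (1 + z * (K * ((Fintype.card V : ℝ) - K)⁻¹)) ^ n *
        Fintype.card (α → Equiv.Perm V) := by
  classical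
  have hpos : (0 : ℝ) < (Fintype.card V : ℝ) - K := by
    rw [sub_pos]; exact_mod_cast hK
  have := sum_prod_weight_le (fun i π => tgt src v c π i)
    (fun i π => if Fresh src v c π i ∧
      tgt src v c π i ∈ S ∪ (Finset.range i).image (tgt src v c π) then z else 1)
    (fun _ => 1 + z * (K * ((Fintype.card V : ℝ) - K)⁻¹)) ?_ ?_ ?_ n ?_
  · simpa [coincidences, Finset.prod_ite, Finset.prod_const] using this
  · intro i π; split_ifs <;> linarith
  · intro i; positivity
  · intro i π π' h
    have h' : ∀ j < i, tgt src v c π j = tgt src v c π' j := fun j hj => h j hj.le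
    have him : (Finset.range i).image (tgt src v c π) = (Finset.range i).image (tgt src v c π') :=
      Finset.image_congr fun j hj => h' j (by simpa using hj)
    simp only [fresh_congr src v c h', h i le_rfl, him]
  · intro i hi π'
    set A := Finset.univ.filter fun π : α → Equiv.Perm V =>
      ∀ j < i, tgt src v c π j = tgt src v c π' j with hA
    set Vis := S ∪ (Finset.range i).image (tgt src v c π') with hVis
    have hVisK : (Vis.card : ℝ) ≤ K := by
      have h1 : Vis.card ≤ _ := Finset.card_union_le S ((Finset.range i).image (tgt src v c π'))
      have h2 : ((Finset.range i).image (tgt src v c π')).card ≤ i := by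
        simpa using Finset.card_image_le (s := Finset.range i) (f := tgt src v c π')
      have : Vis.card ≤ K := by omega
      exact_mod_cast this
    have hcongr : ∀ π ∈ A, (Fresh src v c π i ∧
        tgt src v c π i ∈ S ∪ (Finset.range i).image (tgt src v c π)) ↔
        (Fresh src v c π' i ∧ tgt src v c π i ∈ Vis) := by
      intro π hπ
      have h' := (Finset.mem_filter.1 hπ).2
      have him : (Finset.range i).image (tgt src v c π) =
          (Finset.range i).image (tgt src v c π') :=
        Finset.image_congr fun j hj => h' j (by simpa using hj)
      rw [fresh_congr src v c h', him]
    rw [Finset.sum_congr rfl fun π hπ => by rw [if_congr (hcongr π hπ) rfl rfl]]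
    by_cases hf : Fresh src v c π' i
    · simp only [hf, true_and]
      have hcount : ((A.filter fun π => tgt src v c π i ∈ Vis).card : ℝ) ≤
          K * (((Fintype.card V : ℝ) - K)⁻¹ * A.card) := by
        have e : A.filter (fun π => tgt src v c π i ∈ Vis) =
            Vis.biUnion fun b => Finset.univ.filter fun π =>
              (∀ j < i, tgt src v c π j = tgt src v c π' j) ∧ tgt src v c π i = b := by
          ext π; simp [hA, and_comm]
        rw [e]
        calc _ ≤ ((∑ b ∈ Vis, (Finset.univ.filter fun π =>
              (∀ j < i, tgt src v c π j = tgt src v c π' j) ∧ tgt src v c π i = b).card : ℕ) : ℝ) :=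
              by exact_mod_cast Finset.card_biUnion_le
          _ ≤ ∑ b ∈ Vis, ((Fintype.card V : ℝ) - K)⁻¹ * A.card := by
              push_cast
              exact Finset.sum_le_sum fun b _ => card_tgt_eq_le_div src v c hf (by omega) hK b
          _ ≤ _ := by
              rw [Finset.sum_const, nsmul_eq_mul]
              exact mul_le_mul_of_nonneg_right hVisK (by positivity)
      calc ∑ π ∈ A, (if tgt src v c π i ∈ Vis then z else 1)
          ≤ ∑ π ∈ A, (1 + z * if tgt src v c π i ∈ Vis then 1 else 0) := by
            refine Finset.sum_le_sum fun π _ => ?_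
            split_ifs <;> linarith
        _ = A.card + z * (A.filter fun π => tgt src v c π i ∈ Vis).card := by
            rw [Finset.sum_add_distrib, ← Finset.mul_sum]; simp
        _ ≤ A.card + z * (K * (((Fintype.card V : ℝ) - K)⁻¹ * A.card)) := by gcongr
        _ = _ := by ring
    · simp only [hf, false_and, if_false, Finset.sum_const, nsmul_eq_mul, mul_one]
      refine le_mul_of_one_le_left (by positivity) ?_
      have : 0 ≤ z * (K * ((Fintype.card V : ℝ) - K)⁻¹) := by positivity
      linarith

lemma card_le_coincidences (S : Finset V) {n K : ℕ} (hn : n + S.card ≤ K)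
    (hK : K < Fintype.card V) {z : ℝ} (hz : 1 ≤ z) (r : ℕ) :
    z ^ r * ((Finset.univ.filter fun π : α → Equiv.Perm V =>
        r ≤ coincidences src v c S n π).card : ℝ) ≤
      (1 + z * (K * ((Fintype.card V : ℝ) - K)⁻¹)) ^ n *
        Fintype.card (α → Equiv.Perm V) := by
  refine le_trans ?_ (sum_pow_coincidences_le src v c S hn hK hz)
  rw [mul_comm, ← nsmul_eq_mul]
  refine (Finset.card_nsmul_le_sum _ (fun π => z ^ coincidences src v c S n π) _ ?_).trans ?_
  · intro π hπ
    exact pow_le_pow_right₀ hz (Finset.mem_filter.1 hπ).2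
  · exact Finset.sum_le_sum_of_subset_of_nonneg (Finset.subset_univ _)
      fun _ _ _ => by positivity

open Classical in
/-- The probability that the fresh queries with indices in `I` all take prescribed values. -/
lemma card_prescribed_le {n K : ℕ} (hn : n ≤ K) (hK : K < Fintype.card V)
    (I : Finset ℕ) (hI : I ⊆ Finset.range n) (y : ℕ → V) :
    ((Finset.univ.filter fun π : α → Equiv.Perm V =>
        ∀ i ∈ I, Fresh src v c π i ∧ tgt src v c π i = y i).card : ℝ) ≤
      ((Fintype.card V : ℝ) - K)⁻¹ ^ I.card * Fintype.card (α → Equiv.Perm V) := by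
  classical
  have hpos : (0 : ℝ) < (Fintype.card V : ℝ) - K := by
    rw [sub_pos]; exact_mod_cast hK
  have := sum_prod_weight_le (fun i π => tgt src v c π i)
    (fun i π => if i ∈ I then if Fresh src v c π i ∧ tgt src v c π i = y i then 1 else 0 else 1)
    (fun i => if i ∈ I then ((Fintype.card V : ℝ) - K)⁻¹ else 1) ?_ ?_ ?_ n ?_
  · rw [Finset.prod_ite_mem, Finset.inter_eq_right.2 hI, Finset.prod_const] at this
    refine le_trans (le_of_eq ?_) this
    rw [← Finset.sum_boole]
    refine Finset.sum_congr rfl fun π _ => ?_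
    rw [Finset.prod_ite_mem, Finset.inter_eq_right.2 hI, Finset.prod_boole]
  · intro i π; split_ifs <;> norm_num
  · intro i; split_ifs <;> positivity
  · intro i π π' h
    simp only [fresh_congr src v c fun j hj => h j (le_of_lt hj), h i le_rfl]
  · intro i hi π'
    by_cases hiI : i ∈ I
    · simp only [hiI, if_true]
      by_cases hf : Fresh src v c π' i
      · refine le_trans (le_of_eq ?_) (card_tgt_eq_le_div src v c hf (by omega) hK (y i))
        rw [Finset.sum_boole, Finset.filter_filter]
        congr 2
        ext π
        simp only [Finset.mem_filter, Finset.mem_univ, true_and]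
        exact and_congr_right fun h => by simp [fresh_congr src v c h, hf]
      · rw [Finset.sum_eq_zero]
        · positivity
        · intro π hπ
          rw [fresh_congr src v c (Finset.mem_filter.1 hπ).2]
          simp [hf]
    · simp [hiI]

end Trajectory

section ClosedWalk

variable {α V : Type*}

/-- The walk from `x` reading the letters `c 0, c 1, …`. -/
def walk (c : ℕ → α × Bool) (π : α → Equiv.Perm V) (x : V) : ℕ → V
  | 0 => x
  | t + 1 => act π (c t) (walk c π x t)

/-- An infinite periodic word which is reduced and whose period `ℓ` is minimal. -/
structure PrimitiveCycle (c : ℕ → α × Bool) (ℓ : ℕ) : Prop where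
  length_pos : 0 < ℓ
  periodic : ∀ i, c (i + ℓ) = c i
  reduced : ∀ i, c (i + 1) ≠ flip (c i)
  primitive : ∀ τ, 0 < τ → τ < ℓ → ∃ i, c (i + τ) ≠ c i

namespace PrimitiveCycle

variable {c : ℕ → α × Bool} {ℓ : ℕ} (hc : PrimitiveCycle c ℓ) {π : α → Equiv.Perm V}

include hc

lemma periodic_mul (i m : ℕ) : c (i + ℓ * m) = c i := by
  induction m with
  | zero => rfl
  | succ m ih => rw [Nat.mul_succ, ← add_assoc, hc.periodic, ih]

lemma mod_eq (i : ℕ) : c (i % ℓ) = c i := by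
  conv_rhs => rw [← Nat.mod_add_div i ℓ, hc.periodic_mul]

lemma walk_add {x : V} (hx : walk c π x ℓ = x) (t : ℕ) : walk c π x (t + ℓ) = walk c π x t := by
  induction t with
  | zero => simpa [walk] using hx
  | succ t ih =>
    rw [show t + 1 + ℓ = (t + ℓ) + 1 by ring, walk, ih, hc.periodic, ← walk]

lemma walk_add_mul {x : V} (hx : walk c π x ℓ = x) (t m : ℕ) :
    walk c π x (t + ℓ * m) = walk c π x t := by
  induction m with
  | zero => rfl
  | succ m ih => rw [Nat.mul_succ, ← add_assoc, hc.walk_add hx, ih]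

lemma walk_mod {x : V} (hx : walk c π x ℓ = x) (t : ℕ) : walk c π x (t % ℓ) = walk c π x t := by
  conv_rhs => rw [← Nat.mod_add_div t ℓ, hc.walk_add_mul hx]

omit hc in
lemma walk_cancel {x y : V} (t : ℕ) (h : walk c π x t = walk c π y t) : x = y := by
  induction t with
  | zero => exact h
  | succ t ih => exact ih ((act π (c t)).injective h)

variable {S : Finset V} (hS : ∀ x ∈ S, walk c π x ℓ = x)
  (htwo : ∀ x ∈ S, ∀ y ∈ S, ∀ t u, walk c π x (t + 1) = walk c π y (u + 1) →
    (c (t + 1) = c (u + 1) ∧ c t = c u) ∨ (c (t + 1) = flip (c u) ∧ flip (c t) = c (u + 1)))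

include htwo

/-- Two closed walks cannot traverse each other in opposite directions. -/
lemma not_opposite {x y : V} (hx : x ∈ S) (hy : y ∈ S) (n a b : ℕ) (hab : b = a + n)
    (h : walk c π x (a + 1) = walk c π y (b + 1)) (h1 : c (a + 1) = flip (c b)) : False := by
  induction n using Nat.strong_induction_on generalizing a b with
  | _ n ih =>
    match n with
    | 0 =>
      rw [add_zero] at hab
      subst hab
      exact hc.reduced _ h1
    | 1 =>
      subst hab
      exact flip_ne _ h1.symm
    | n + 2 =>
      obtain ⟨b', rfl⟩ : ∃ b', b = b' + 1 := ⟨a + n + 1, by omega⟩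
      have h2 : walk c π x (a + 1 + 1) = walk c π y (b' + 1) := by
        rw [walk, h1, act_flip, h, Equiv.Perm.inv_eq_iff_eq]; rfl
      rcases htwo x hx y hy _ _ h2 with ⟨_, h4⟩ | ⟨h3, _⟩
      · have := h1.symm.trans h4
        exact hc.reduced b' (by rw [← this, flip_flip])
      · exact ih n (by omega) (a + 1) b' (by omega) h2 h3

include hS

lemma parallel {x y : V} (hx : x ∈ S) (hy : y ∈ S) (t u : ℕ)
    (h : walk c π x (t + 1) = walk c π y (u + 1)) : c (t + 1) = c (u + 1) := by
  rcases htwo x hx y hy t u h with h1 | h1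
  · exact h1.1
  · refine (hc.not_opposite htwo hx hy (u + ℓ * t - t) t (u + ℓ * t) ?_ ?_ ?_).elim
    · have : t ≤ ℓ * t := Nat.le_mul_of_pos_left _ hc.length_pos
      omega
    · rw [h, show u + ℓ * t + 1 = u + 1 + ℓ * t by ring, hc.walk_add_mul (hS y hy)]
    · rw [hc.periodic_mul]; exact h1.1

lemma eq_of_le {x y : V} (hx : x ∈ S) (hy : y ∈ S) {t u : ℕ} (htu : t ≤ u) (hu : u < ℓ)
    (h : walk c π x t = walk c π y u) : t = u ∧ x = y := by
  have hshift : ∀ i, walk c π x (t + ℓ + i) = walk c π y (u + ℓ + i) := by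
    intro i
    induction i with
    | zero => simpa [hc.walk_add (hS x hx), hc.walk_add (hS y hy)] using h
    | succ i ih =>
      obtain ⟨ℓ', hℓ⟩ : ∃ ℓ', ℓ = ℓ' + 1 := ⟨ℓ - 1, by have := hc.length_pos; omega⟩
      have := hc.parallel hS htwo hx hy (t + ℓ' + i) (u + ℓ' + i) (by
        rw [hℓ] at ih
        rw [show t + ℓ' + i + 1 = t + (ℓ' + 1) + i by ring, ih]
        congr 1; ring)
      rw [← add_assoc, ← add_assoc, walk, walk, ih]
      congr 2
      rw [hℓ, show t + (ℓ' + 1) + i = t + ℓ' + i + 1 by ring, this]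
      congr 1; ring
  have htu' : t = u := by
    by_contra hne
    obtain ⟨i, hi⟩ := hc.primitive (u - t) (by omega) (by omega)
    refine hi ?_
    have hle : t + 1 ≤ ℓ * (t + 1) := Nat.le_mul_of_pos_left _ hc.length_pos
    have hpar2 := hc.parallel hS htwo hx hy (t + ℓ + (i + ℓ * (t + 1) - (t + 1)))
      (u + ℓ + (i + ℓ * (t + 1) - (t + 1))) (by
        exact hshift (i + ℓ * (t + 1) - (t + 1) + 1))
    rw [show t + ℓ + (i + ℓ * (t + 1) - (t + 1)) + 1 = i + ℓ * (t + 2) by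
        rw [show ℓ * (t + 2) = ℓ * (t + 1) + ℓ by ring]; omega,
      show u + ℓ + (i + ℓ * (t + 1) - (t + 1)) + 1 = i + (u - t) + ℓ * (t + 2) by
        rw [show ℓ * (t + 2) = ℓ * (t + 1) + ℓ by ring]; omega,
      hc.periodic_mul, hc.periodic_mul] at hpar2
    exact hpar2.symm
  subst htu'
  exact ⟨rfl, walk_cancel _ h⟩

lemma injOn_walk : Set.InjOn (fun p : V × ℕ => walk c π p.1 p.2) {p | p.1 ∈ S ∧ p.2 < ℓ} := by
  rintro ⟨x, t⟩ ⟨hx, ht⟩ ⟨y, u⟩ ⟨hy, hu⟩ h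
  simp only at hx hy ht hu h
  rcases le_total t u with htu | htu
  · obtain ⟨rfl, rfl⟩ := hc.eq_of_le hS htwo hx hy htu hu h
    rfl
  · obtain ⟨rfl, rfl⟩ := hc.eq_of_le hS htwo hy hx htu ht h.symm
    rfl

end PrimitiveCycle

variable [DecidableEq α] [DecidableEq V]

/-- The vertices visited by the walks from `S`. -/
def visited (c : ℕ → α × Bool) (ℓ : ℕ) (π : α → Equiv.Perm V) (S : Finset V) : Finset V :=
  (S ×ˢ Finset.range ℓ).image fun p => walk c π p.1 p.2

/-- The half-edges used by the walks from `S`. -/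
def halfEdges (c : ℕ → α × Bool) (ℓ : ℕ) (π : α → Equiv.Perm V) (S : Finset V) :
    Finset ((α × Bool) × V) :=
  ((S ×ˢ Finset.range ℓ).image fun p => (c p.2, walk c π p.1 p.2)) ∪
    (S ×ˢ Finset.range ℓ).image fun p => (flip (c p.2), walk c π p.1 (p.2 + 1))

namespace PrimitiveCycle

variable {c : ℕ → α × Bool} {ℓ : ℕ} (hc : PrimitiveCycle c ℓ) {π : α → Equiv.Perm V}
  {S : Finset V} (hS : ∀ x ∈ S, walk c π x ℓ = x)

include hc hS

omit [DecidableEq α] in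
lemma walk_mem_visited {x : V} (hx : x ∈ S) (t : ℕ) : walk c π x t ∈ visited c ℓ π S := by
  rw [← hc.walk_mod (hS x hx)]
  exact Finset.mem_image.2 ⟨(x, t % ℓ), by simp [hx, Nat.mod_lt _ hc.length_pos], rfl⟩

lemma out_mem_halfEdges {x : V} (hx : x ∈ S) (t : ℕ) :
    (c t, walk c π x t) ∈ halfEdges c ℓ π S := by
  rw [← hc.walk_mod (hS x hx), ← hc.mod_eq]
  exact Finset.mem_union_left _
    (Finset.mem_image.2 ⟨(x, t % ℓ), by simp [hx, Nat.mod_lt _ hc.length_pos], rfl⟩)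

lemma in_mem_halfEdges {x : V} (hx : x ∈ S) (t : ℕ) :
    (flip (c t), walk c π x (t + 1)) ∈ halfEdges c ℓ π S := by
  rw [walk, ← hc.walk_mod (hS x hx), ← hc.mod_eq, ← walk]
  exact Finset.mem_union_right _
    (Finset.mem_image.2 ⟨(x, t % ℓ), by simp [hx, Nat.mod_lt _ hc.length_pos], rfl⟩)

lemma two_le_card_fiber {v : V} (hv : v ∈ visited c ℓ π S) :
    2 ≤ ((halfEdges c ℓ π S).filter fun e => e.2 = v).card := by
  obtain ⟨⟨x, t⟩, hp, rfl⟩ := Finset.mem_image.1 hv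
  have hx : x ∈ S := (Finset.mem_product.1 hp).1
  obtain ⟨ℓ', hℓ⟩ : ∃ ℓ', ℓ = ℓ' + 1 := ⟨ℓ - 1, by have := hc.length_pos; omega⟩
  have e : walk c π x (t + ℓ' + 1) = walk c π x t := by
    rw [add_assoc, ← hℓ, hc.walk_add (hS x hx)]
  have h1 := hc.out_mem_halfEdges hS hx (t + ℓ' + 1)
  have h2 := hc.in_mem_halfEdges hS hx (t + ℓ')
  rw [e] at h1 h2
  rw [← Finset.card_pair (a := (c (t + ℓ' + 1), walk c π x t))
    (b := (flip (c (t + ℓ')), walk c π x t)) (by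
      intro h
      exact hc.reduced _ (congrArg Prod.fst h))]
  refine Finset.card_le_card ?_
  intro e he
  simp only [Finset.mem_insert, Finset.mem_singleton] at he
  rcases he with rfl | rfl <;> simp [h1, h2]

/-- Every visited vertex of a union of cyclically reduced closed walks has degree at least two; if
all degrees are two, the walks are disjoint simple cycles. -/
lemma injOn_of_card_halfEdges_le
    (hle : (halfEdges c ℓ π S).card ≤ 2 * (visited c ℓ π S).card) :
    Set.InjOn (fun p : V × ℕ => walk c π p.1 p.2) {p | p.1 ∈ S ∧ p.2 < ℓ} := by
  have hmaps : ∀ e ∈ halfEdges c ℓ π S, e.2 ∈ visited c ℓ π S := by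
    intro e he
    rcases Finset.mem_union.1 he with h | h
    · obtain ⟨p, hp, rfl⟩ := Finset.mem_image.1 h
      exact hc.walk_mem_visited hS (Finset.mem_product.1 hp).1 _
    · obtain ⟨p, hp, rfl⟩ := Finset.mem_image.1 h
      exact hc.walk_mem_visited hS (Finset.mem_product.1 hp).1 _
  have hsum := Finset.card_eq_sum_card_fiberwise (f := Prod.snd) (s := halfEdges c ℓ π S)
    (t := visited c ℓ π S) hmaps
  have hge : ∀ v ∈ visited c ℓ π S, 2 ≤ ((halfEdges c ℓ π S).filter fun e => e.2 = v).card :=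
    fun v hv => hc.two_le_card_fiber hS hv
  have heq : ∀ v ∈ visited c ℓ π S,
      2 = ((halfEdges c ℓ π S).filter fun e => e.2 = v).card := by
    refine (Finset.sum_eq_sum_iff_of_le hge).1 (le_antisymm (Finset.sum_le_sum hge) ?_)
    rw [← hsum, Finset.sum_const, smul_eq_mul]
    linarith
  refine hc.injOn_walk hS ?_
  intro x hx y hy t u h
  obtain ⟨e, f, -, hef⟩ :=
    Finset.card_eq_two.1 (heq _ (hc.walk_mem_visited hS hx (t + 1))).symm
  have hmem : ∀ a, (a, walk c π x (t + 1)) ∈ halfEdges c ℓ π S → a = e.1 ∨ a = f.1 := by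
    intro a ha
    have : (a, walk c π x (t + 1)) ∈ ({e, f} : Finset _) := by
      rw [← hef]; simp [ha]
    simp only [Finset.mem_insert, Finset.mem_singleton] at this
    rcases this with h | h
    · exact Or.inl (by rw [← h])
    · exact Or.inr (by rw [← h])
  have h1 := hmem _ (hc.out_mem_halfEdges hS hx (t + 1))
  have h2 := hmem _ (hc.in_mem_halfEdges hS hx t)
  have h3 := hmem (c (u + 1)) (by rw [h]; exact hc.out_mem_halfEdges hS hy (u + 1))
  have h4 := hmem (flip (c u)) (by rw [h]; exact hc.in_mem_halfEdges hS hy u)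
  have r1 := hc.reduced t
  have r2 := hc.reduced u
  have inj : flip (c t) = flip (c u) → c t = c u := fun h => by
    rw [← flip_flip (c t), h, flip_flip]
  grind

end PrimitiveCycle

end ClosedWalk

section Concatenation

variable {α V : Type*}

/-- Restart at `x m` at time `ℓ * m`. -/
def restart (x : ℕ → V) (ℓ : ℕ) (i : ℕ) : Option V := if i % ℓ = 0 then some (x (i / ℓ)) else none

variable {c : ℕ → α × Bool} {ℓ : ℕ}

lemma PrimitiveCycle.pos_restart (hc : PrimitiveCycle c ℓ) (x : ℕ → V) (π : α → Equiv.Perm V)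
    (i : ℕ) : pos (restart x ℓ) (x 0) c π i = walk c π (x (i / ℓ)) (i % ℓ) := by
  induction i with
  | zero => simp [pos, walk]
  | succ i ih =>
    rw [pos, restart]
    by_cases h : (i + 1) % ℓ = 0
    · simp [h, walk]
    · have h1 : (i + 1) / ℓ = i / ℓ := by
        rw [Nat.succ_div_of_not_dvd]
        rwa [Nat.dvd_iff_mod_eq_zero]
      have h2 : (i + 1) % ℓ = i % ℓ + 1 := by
        rw [Nat.add_mod]
        rcases Nat.lt_or_ge 1 ℓ with hℓ | hℓ
        · rw [Nat.mod_eq_of_lt hℓ]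
          refine Nat.mod_eq_of_lt ?_
          rcases Nat.lt_or_ge (i % ℓ + 1) ℓ with h' | h'
          · exact h'
          · exfalso
            have h3 : i % ℓ + 1 = ℓ := by have := Nat.mod_lt i hc.length_pos; omega
            apply h
            rw [Nat.add_mod, Nat.mod_eq_of_lt hℓ, h3, Nat.mod_self]
        · have : ℓ = 1 := le_antisymm hℓ hc.length_pos
          subst this
          exact absurd (Nat.mod_one _) h
      rw [if_neg h, Option.getD_none, ih, h1, h2, walk, hc.mod_eq]

lemma PrimitiveCycle.tgt_restart (hc : PrimitiveCycle c ℓ) (x : ℕ → V) (π : α → Equiv.Perm V)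
    (i : ℕ) : tgt (restart x ℓ) (x 0) c π i = walk c π (x (i / ℓ)) (i % ℓ + 1) := by
  rw [tgt, hc.pos_restart, walk, hc.mod_eq]

variable [DecidableEq α] [DecidableEq V]

open Classical in
/-- The half-edges of the fresh queries are all the half-edges of the queries. -/
lemma exists_fresh_halfEdge (src : ℕ → Option V) (v : V) (c : ℕ → α × Bool)
    (π : α → Equiv.Perm V) (n i : ℕ) (hi : i < n) :
    let F := (Finset.range n).filter fun i => Fresh src v c π i
    let E := F.image (fun i => (c i, pos src v c π i)) ∪
      F.image (fun i => (flip (c i), tgt src v c π i))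
    (c i, pos src v c π i) ∈ E ∧ (flip (c i), tgt src v c π i) ∈ E := by
  intro F E
  induction i using Nat.strong_induction_on with
  | _ i ih =>
    by_cases hf : Fresh src v c π i
    · have hF : i ∈ F := by simp [F, hi, hf]
      exact ⟨Finset.mem_union_left _ (Finset.mem_image_of_mem _ hF),
        Finset.mem_union_right _ (Finset.mem_image_of_mem _ hF)⟩
    · obtain ⟨j, hj, ⟨h1, h2⟩ | ⟨h1, h2⟩⟩ : ∃ j < i,
          (c j = c i ∧ pos src v c π j = pos src v c π i) ∨
            (flip (c j) = c i ∧ tgt src v c π j = pos src v c π i) := by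
        by_contra h
        push Not at h
        exact hf fun j hj => ⟨fun h' => (h j hj).1 h'.1 h'.2, fun h' => (h j hj).2 h'.1 h'.2⟩
      · have := ih j hj (hj.trans hi)
        simp only [tgt, h1, h2] at this
        exact this
      · have := ih j hj (hj.trans hi)
        rw [← h1, flip_flip, tgt, ← h1, ← h2, act_flip]
        refine ⟨this.2, ?_⟩
        rw [tgt, Equiv.Perm.inv_eq_iff_eq.2 rfl]
        exact this.1

/-- The indices of the queries that close up the successive walks. -/
def closing (ℓ d : ℕ) : Finset ℕ := (Finset.range d).image fun m => ℓ * m + (ℓ - 1)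

lemma card_closing {ℓ : ℕ} (hℓ : 0 < ℓ) (d : ℕ) : (closing ℓ d).card = d := by
  rw [closing, Finset.card_image_of_injective, Finset.card_range]
  intro a b h
  simpa [hℓ.ne'] using h

lemma closing_subset {ℓ : ℕ} (hℓ : 0 < ℓ) (d : ℕ) : closing ℓ d ⊆ Finset.range (d * ℓ) := by
  intro i hi
  obtain ⟨m, hm, rfl⟩ := Finset.mem_image.1 hi
  have hm := Finset.mem_range.1 hm
  rw [Finset.mem_range]
  have : (m + 1) * ℓ ≤ d * ℓ := Nat.mul_le_mul_right _ hm
  have h2 : ℓ * m + (ℓ - 1) + 1 = (m + 1) * ℓ := by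
    rw [add_mul, one_mul, mul_comm]; omega
  omega

namespace PrimitiveCycle

variable (hc : PrimitiveCycle c ℓ) {π : α → Equiv.Perm V} {S : Finset V}
  (hS : ∀ x ∈ S, walk c π x ℓ = x) (x : ℕ → V) (hx : Set.InjOn x (Finset.range S.card))
  (hxS : (Finset.range S.card).image x = S)

include hc hS hx hxS

omit [DecidableEq α] in
lemma closing_of_injOn
    (hinj : Set.InjOn (fun p : V × ℕ => walk c π p.1 p.2) {p | p.1 ∈ S ∧ p.2 < ℓ}) :
    ∀ i ∈ closing ℓ S.card, Fresh (restart x ℓ) (x 0) c π i ∧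
      tgt (restart x ℓ) (x 0) c π i = x (i / ℓ) := by
  have hmem : ∀ m < S.card, x m ∈ S := fun m hm => by
    rw [← hxS]; exact Finset.mem_image_of_mem _ (Finset.mem_range.2 hm)
  have hℓ := hc.length_pos
  intro i hi
  obtain ⟨m, hm, rfl⟩ := Finset.mem_image.1 hi
  have hm := Finset.mem_range.1 hm
  have hdiv : (ℓ * m + (ℓ - 1)) / ℓ = m := by
    rw [Nat.mul_add_div hℓ, Nat.div_eq_of_lt (by omega), add_zero]
  have hmod : (ℓ * m + (ℓ - 1)) % ℓ = ℓ - 1 := by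
    rw [Nat.mul_add_mod, Nat.mod_eq_of_lt (by omega)]
  have hcl : tgt (restart x ℓ) (x 0) c π (ℓ * m + (ℓ - 1)) = x ((ℓ * m + (ℓ - 1)) / ℓ) := by
    rw [hc.tgt_restart, hdiv, hmod, Nat.sub_add_cancel hℓ]
    exact hS _ (hmem m hm)
  refine ⟨fun j hj => ⟨?_, ?_⟩, hcl⟩
  · rintro ⟨-, h⟩
    rw [hc.pos_restart, hc.pos_restart, hdiv, hmod] at h
    have hjm : j / ℓ ≤ m := hdiv ▸ Nat.div_le_div_right hj.le
    have := hinj (x₁ := (x (j / ℓ), j % ℓ)) (x₂ := (x m, ℓ - 1))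
      ⟨hmem _ (by omega), Nat.mod_lt _ hℓ⟩ ⟨hmem _ hm, by change ℓ - 1 < ℓ; omega⟩ h
    simp only [Prod.mk.injEq] at this
    have h3 : j / ℓ = m := hx (by simp; omega) (by simpa using hm) this.1
    have h4 := Nat.div_add_mod j ℓ
    rw [h3, this.2] at h4
    omega
  · rintro ⟨h1, h⟩
    have hjm : j / ℓ ≤ m := hdiv ▸ Nat.div_le_div_right hj.le
    have hxj := hmem (j / ℓ) (by omega)
    rw [hc.pos_restart, hdiv, hmod, hc.tgt_restart, ← hc.walk_mod (hS _ hxj)] at h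
    have := hinj (x₁ := (x (j / ℓ), (j % ℓ + 1) % ℓ)) (x₂ := (x m, ℓ - 1))
      ⟨hxj, Nat.mod_lt _ hℓ⟩ ⟨hmem _ hm, by change ℓ - 1 < ℓ; omega⟩ h
    simp only [Prod.mk.injEq, Nat.mod_add_mod] at this
    apply hc.reduced j
    rw [h1, ← hc.mod_eq (j + 1), this.2, ← hc.mod_eq (ℓ * m + (ℓ - 1)), hmod]

/-- If all the walks from `S` close up, then either there are more coincidences than walks, or
each walk closes up by a fresh query. -/
lemma lt_coincidences_or_closing :
    S.card + 1 ≤ coincidences (restart x ℓ) (x 0) c S (S.card * ℓ) π ∨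
    ∀ i ∈ closing ℓ S.card, Fresh (restart x ℓ) (x 0) c π i ∧
      tgt (restart x ℓ) (x 0) c π i = x (i / ℓ) := by
  classical
  by_cases hle : (halfEdges c ℓ π S).card ≤ 2 * (visited c ℓ π S).card
  · exact Or.inr (hc.closing_of_injOn hS x hx hxS (hc.injOn_of_card_halfEdges_le hS hle))
  left
  have hmem : ∀ m < S.card, x m ∈ S := fun m hm => by
    rw [← hxS]; exact Finset.mem_image_of_mem _ (Finset.mem_range.2 hm)
  have hℓ := hc.length_pos
  set n := S.card * ℓ with hn
  set src := restart x ℓ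
  set F := (Finset.range n).filter fun i => Fresh src (x 0) c π i with hF
  set G := F.filter fun i => tgt src (x 0) c π i ∈ S ∪ (Finset.range i).image (tgt src (x 0) c π)
    with hG
  have hcoin : coincidences src (x 0) c S n π = G.card := by
    rw [coincidences, hG, hF, Finset.filter_filter]
  have hEF : (halfEdges c ℓ π S).card ≤ 2 * F.card := by
    have hsub : halfEdges c ℓ π S ⊆ F.image (fun i => (c i, pos src (x 0) c π i)) ∪
        F.image (fun i => (flip (c i), tgt src (x 0) c π i)) := by
      intro e he
      have key : ∀ p ∈ S ×ˢ Finset.range ℓ, ∃ i < n, c i = c p.2 ∧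
          pos src (x 0) c π i = walk c π p.1 p.2 ∧
          tgt src (x 0) c π i = walk c π p.1 (p.2 + 1) := by
        rintro ⟨y, t⟩ hp
        obtain ⟨hy, ht⟩ := Finset.mem_product.1 hp
        simp only [Finset.mem_range] at hy ht ⊢
        rw [← hxS] at hy
        obtain ⟨m, hm, rfl⟩ := Finset.mem_image.1 hy
        have hm := Finset.mem_range.1 hm
        refine ⟨t + ℓ * m, ?_, hc.periodic_mul _ _, ?_, ?_⟩
        · have : (m + 1) * ℓ ≤ S.card * ℓ := Nat.mul_le_mul_right _ hm
          rw [hn]; linarith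
        · rw [hc.pos_restart, Nat.add_mul_div_left _ _ hℓ, Nat.div_eq_of_lt ht, zero_add,
            Nat.add_mul_mod_self_left, Nat.mod_eq_of_lt ht]
        · rw [hc.tgt_restart, Nat.add_mul_div_left _ _ hℓ, Nat.div_eq_of_lt ht, zero_add,
            Nat.add_mul_mod_self_left, Nat.mod_eq_of_lt ht]
      rcases Finset.mem_union.1 he with h | h
      · obtain ⟨p, hp, rfl⟩ := Finset.mem_image.1 h
        obtain ⟨i, hi, e1, e2, -⟩ := key p hp
        rw [← e1, ← e2]
        exact (exists_fresh_halfEdge src (x 0) c π n i hi).1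
      · obtain ⟨p, hp, rfl⟩ := Finset.mem_image.1 h
        obtain ⟨i, hi, e1, -, e3⟩ := key p hp
        rw [← e1, ← e3]
        exact (exists_fresh_halfEdge src (x 0) c π n i hi).2
    refine (Finset.card_le_card hsub).trans ((Finset.card_union_le _ _).trans ?_)
    have h1 := Finset.card_image_le (s := F) (f := fun i => (c i, pos src (x 0) c π i))
    have h2 := Finset.card_image_le (s := F) (f := fun i => (flip (c i), tgt src (x 0) c π i))
    omega
  have hSV : S ⊆ visited c ℓ π S := fun y hy => hc.walk_mem_visited hS hy 0
  have hnew : (F.filter fun i => tgt src (x 0) c π i ∉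
      S ∪ (Finset.range i).image (tgt src (x 0) c π)).card ≤ (visited c ℓ π S \ S).card := by
    refine Finset.card_le_card_of_injOn (tgt src (x 0) c π) ?_ ?_
    · intro i hi
      obtain ⟨hiF, hi⟩ := Finset.mem_filter.1 hi
      rw [Finset.mem_union, not_or] at hi
      refine Finset.mem_coe.2 (Finset.mem_sdiff.2 ⟨?_, hi.1⟩)
      rw [hc.tgt_restart]
      refine hc.walk_mem_visited hS (hmem _ ?_) _
      have := Finset.mem_range.1 (Finset.mem_filter.1 hiF).1
      rw [Nat.div_lt_iff_lt_mul hℓ]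
      exact this
    · intro i hi j hj hij
      have hi := (Finset.mem_filter.1 hi).2
      have hj := (Finset.mem_filter.1 hj).2
      simp only [Finset.mem_union, Finset.mem_image, Finset.mem_range, not_or, not_exists,
        not_and] at hi hj
      rcases lt_trichotomy i j with h | h | h
      · exact absurd hij (hj.2 i h)
      · exact h
      · exact absurd hij.symm (hi.2 j h)
  have hsplit : G.card + (F.filter fun i => tgt src (x 0) c π i ∉
      S ∪ (Finset.range i).image (tgt src (x 0) c π)).card = F.card :=
    Finset.card_filter_add_card_filter_not _
  rw [Finset.card_sdiff_of_subset hSV] at hnew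
  have hSVc := Finset.card_le_card hSV
  rw [hcoin]
  omega

end PrimitiveCycle

end Concatenation

section FixedPoints

variable {α V : Type*} [Fintype α] [DecidableEq α] [Fintype V] [DecidableEq V]
  {c : ℕ → α × Bool} {ℓ : ℕ}

omit [Fintype V] in
lemma exists_enumeration (S : Finset V) (hne : S.Nonempty) :
    ∃ x : ℕ → V, Set.InjOn x (Finset.range S.card) ∧ (Finset.range S.card).image x = S := by
  obtain ⟨v, hv⟩ := hne
  refine ⟨fun i => if h : i < S.card then S.equivFin.symm ⟨i, h⟩ else v, ?_, ?_⟩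
  · intro i hi j hj h
    simp only [Finset.coe_range, Set.mem_Iio] at hi hj
    simp only [hi, hj, dif_pos] at h
    simpa using S.equivFin.symm.injective (Subtype.ext h)
  · ext y
    simp only [Finset.mem_image, Finset.mem_range]
    constructor
    · rintro ⟨i, hi, rfl⟩
      simp [hi]
    · intro hy
      exact ⟨S.equivFin ⟨y, hy⟩, (S.equivFin ⟨y, hy⟩).2, by simp⟩

open Classical in
lemma PrimitiveCycle.card_closed_le (hc : PrimitiveCycle c ℓ) (S : Finset V) (hne : S.Nonempty)
    {K : ℕ} (hn : S.card * ℓ + S.card ≤ K) (hK : K < Fintype.card V) {z : ℝ} (hz : 1 ≤ z) :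
    ((Finset.univ.filter fun π : α → Equiv.Perm V => ∀ x ∈ S, walk c π x ℓ = x).card : ℝ) ≤
      (((Fintype.card V : ℝ) - K)⁻¹ ^ S.card + (z ^ (S.card + 1))⁻¹ *
        (1 + z * (K * ((Fintype.card V : ℝ) - K)⁻¹)) ^ (S.card * ℓ)) *
        Fintype.card (α → Equiv.Perm V) := by
  obtain ⟨x, hx, hxS⟩ := exists_enumeration S hne
  have h1 := card_le_coincidences (α := α) (restart x ℓ) (x 0) c S hn hK hz (S.card + 1)
  have h2 := card_prescribed_le (α := α) (restart x ℓ) (x 0) c (n := S.card * ℓ) (K := K)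
    (by omega) hK (closing ℓ S.card) (closing_subset hc.length_pos _) (fun i => x (i / ℓ))
  rw [card_closing hc.length_pos] at h2
  have hzp : 0 < z ^ (S.card + 1) := by positivity
  rw [mul_comm, ← le_div_iff₀ hzp, div_eq_inv_mul, ← mul_assoc] at h1
  rw [add_mul, add_comm]
  refine le_trans ?_ (add_le_add h1 h2)
  norm_cast
  refine le_trans (Finset.card_le_card ?_) (Finset.card_union_le _ _)
  intro π hπ
  have hπ := (Finset.mem_filter.1 hπ).2
  rw [Finset.mem_union, Finset.mem_filter, Finset.mem_filter]
  rcases hc.lt_coincidences_or_closing hπ x hx hxS with h | h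
  · exact Or.inl ⟨Finset.mem_univ _, h⟩
  · exact Or.inr ⟨Finset.mem_univ _, h⟩

lemma inv_sub_pow_le {N K : ℝ} {d : ℕ} (hK : 1 ≤ K) (hd : (d : ℝ) ≤ K) (hN : 4 * K ^ 2 ≤ N) :
    (N - K)⁻¹ ^ d ≤ N⁻¹ ^ d * (1 + 2 * K ^ 2 / N) := by
  have hN0 : 0 < N := by nlinarith
  have hKN : K < N := by nlinarith
  have hx : K ^ 2 / N ≤ 1 / 4 := by rw [div_le_iff₀ hN0]; linarith
  have hx0 : 0 ≤ K ^ 2 / N := by positivity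
  have hb : 1 - K ^ 2 / N ≤ (1 - K / N) ^ d := by
    have := one_add_mul_le_pow (a := -(K / N)) (by
      have : K / N ≤ 1 := by rw [div_le_one hN0]; exact hKN.le
      linarith) d
    have h2 : (d : ℝ) * (K / N) ≤ K ^ 2 / N := by
      rw [sq, mul_div_assoc]; gcongr
    calc _ ≤ 1 + (d : ℝ) * -(K / N) := by linarith
      _ ≤ _ := by rw [sub_eq_add_neg]; exact this
  have e : (N - K) = N * (1 - K / N) := by field_simp
  rw [e, mul_inv, mul_pow]
  refine mul_le_mul_of_nonneg_left ?_ (by positivity)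
  rw [inv_pow]
  refine (inv_anti₀ (by linarith) hb).trans ?_
  rw [inv_le_iff_one_le_mul₀ (by linarith), mul_div_assoc]
  nlinarith

open Classical in
lemma PrimitiveCycle.card_closed_le_inv_pow (hc : PrimitiveCycle c ℓ) (S : Finset V)
    (hne : S.Nonempty) {k K : ℕ} (hSk : S.card ≤ k) (hn : k * ℓ + k ≤ K)
    (hK : 4 * K ^ 2 ≤ Fintype.card V) :
    ((Finset.univ.filter fun π : α → Equiv.Perm V => ∀ x ∈ S, walk c π x ℓ = x).card : ℝ) ≤
      (Fintype.card V : ℝ)⁻¹ ^ S.card * (1 + 4 * (2 * (K : ℝ) ^ 2) ^ (k + 1) / Fintype.card V) *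
        Fintype.card (α → Equiv.Perm V) := by
  have hS0 : 0 < S.card := hne.card_pos
  have hK1 : 1 ≤ K := by omega
  have hSK : S.card * ℓ + S.card ≤ K := by
    have := Nat.mul_le_mul_right ℓ hSk
    omega
  set d := S.card with hd
  have hKN : K < Fintype.card V := by nlinarith
  set N : ℝ := (Fintype.card V : ℝ) with hN
  have hK1' : (1 : ℝ) ≤ K := by exact_mod_cast hK1
  have hKN' : 4 * (K : ℝ) ^ 2 ≤ N := by rw [hN]; exact_mod_cast hK
  have hN0 : 0 < N := by nlinarith
  have hz : 1 ≤ N / (2 * (K : ℝ) ^ 2) := by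
    rw [le_div_iff₀ (by positivity)]; nlinarith
  refine (hc.card_closed_le S hne hSK hKN hz).trans ?_
  refine mul_le_mul_of_nonneg_right ?_ (by positivity)
  have h1 : (N - K)⁻¹ ^ d ≤ N⁻¹ ^ d * (1 + 2 * K ^ 2 / N) :=
    inv_sub_pow_le hK1' (by exact_mod_cast (by omega : d ≤ K)) hKN'
  have h2 : N / (2 * (K : ℝ) ^ 2) * (K * (N - K)⁻¹) ≤ 1 / K := by
    have h3 : N / 2 ≤ N - K := by nlinarith
    have h4 : (N - K)⁻¹ ≤ (N / 2)⁻¹ := inv_anti₀ (by positivity) h3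
    calc _ ≤ N / (2 * (K : ℝ) ^ 2) * (K * (N / 2)⁻¹) := by gcongr
      _ = _ := by field_simp
  have h3 : (1 + N / (2 * (K : ℝ) ^ 2) * (K * (N - K)⁻¹)) ^ (d * ℓ) ≤ 3 := by
    have h0 : 0 ≤ N / (2 * (K : ℝ) ^ 2) * (K * (N - K)⁻¹) := by
      have : (0 : ℝ) ≤ (N - K)⁻¹ := inv_nonneg.2 (by nlinarith)
      positivity
    calc _ ≤ (1 + 1 / (K : ℝ)) ^ K := by
          refine (pow_le_pow_left₀ (by linarith) (by linarith) _).trans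
            (pow_le_pow_right₀ ?_ (by omega))
          have : (0 : ℝ) ≤ 1 / K := by positivity
          linarith
      _ ≤ (Real.exp (1 / K)) ^ K := by
          gcongr
          rw [add_comm]; exact Real.add_one_le_exp _
      _ = Real.exp 1 := by
          rw [← Real.exp_nat_mul]; congr 1; field_simp
      _ ≤ 3 := by linarith [Real.exp_one_lt_d9]
  have h4 : 2 * (K : ℝ) ^ 2 ≤ (2 * (K : ℝ) ^ 2) ^ (k + 1) :=
    le_self_pow₀ (by nlinarith) (by omega)
  have h5 : ((N / (2 * (K : ℝ) ^ 2)) ^ (d + 1))⁻¹ ≤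
      N⁻¹ ^ d * ((2 * (K : ℝ) ^ 2) ^ (k + 1) / N) := by
    rw [div_pow, inv_div, pow_succ N, inv_pow]
    have : (2 * (K : ℝ) ^ 2) ^ (d + 1) ≤ (2 * (K : ℝ) ^ 2) ^ (k + 1) :=
      pow_le_pow_right₀ (by nlinarith) (by omega)
    calc _ ≤ (2 * (K : ℝ) ^ 2) ^ (k + 1) / (N ^ d * N) := by gcongr
      _ = _ := by field_simp
  have h0 : 0 ≤ N⁻¹ ^ d * ((2 * (K : ℝ) ^ 2) ^ (k + 1) / N) := by positivity
  calc _ ≤ N⁻¹ ^ d * (1 + 2 * K ^ 2 / N) +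
        N⁻¹ ^ d * ((2 * (K : ℝ) ^ 2) ^ (k + 1) / N) * 3 := by
        refine add_le_add h1 (mul_le_mul h5 h3 ?_ h0)
        have : (0 : ℝ) ≤ (N - K)⁻¹ := inv_nonneg.2 (by nlinarith)
        positivity
    _ ≤ N⁻¹ ^ d * (1 + (2 * (K : ℝ) ^ 2) ^ (k + 1) / N) +
        N⁻¹ ^ d * ((2 * (K : ℝ) ^ 2) ^ (k + 1) / N) * 3 := by gcongr
    _ = _ := by ring

lemma sum_inv_pow_card_image_le (k : ℕ) :
    ∑ x : Fin k → V, (Fintype.card V : ℝ)⁻¹ ^ (Finset.univ.image x).card ≤ k.factorial := by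
  induction k with
  | zero => simp
  | succ k ih =>
    rw [← (Fin.consEquiv fun _ : Fin (k + 1) => V).sum_comp, Fintype.sum_prod_type_right]
    have himage : ∀ (v : V) (x : Fin k → V),
        Finset.univ.image (Fin.cons v x : Fin (k + 1) → V) =
          insert v (Finset.univ.image x) := by
      intro v x
      ext y
      simp [Fin.exists_fin_succ, eq_comm]
    have hstep : ∀ x : Fin k → V, ∑ v : V, (Fintype.card V : ℝ)⁻¹ ^
        (Finset.univ.image (Fin.consEquiv (fun _ : Fin (k + 1) => V) (v, x))).card ≤
        (k + 1) * (Fintype.card V : ℝ)⁻¹ ^ (Finset.univ.image x).card := by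
      intro x
      set A := Finset.univ.image x with hA
      have hAk : (A.card : ℝ) ≤ k := by
        have : A.card ≤ k := by simpa using Finset.card_image_le (s := Finset.univ) (f := x)
        exact_mod_cast this
      calc _ ≤ ∑ v : V, ((if v ∈ A then 1 else 0) * (Fintype.card V : ℝ)⁻¹ ^ A.card +
            (Fintype.card V : ℝ)⁻¹ * (Fintype.card V : ℝ)⁻¹ ^ A.card) := by
            refine Finset.sum_le_sum fun v _ => ?_
            change (Fintype.card V : ℝ)⁻¹ ^
              (Finset.univ.image (Fin.cons v x : Fin (k + 1) → V)).card ≤ _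
            rw [himage]
            by_cases hv : v ∈ A
            · rw [Finset.insert_eq_of_mem hv, if_pos hv, one_mul]
              exact le_add_of_nonneg_right (by positivity)
            · rw [Finset.card_insert_of_notMem hv, if_neg hv, pow_succ]
              exact le_of_eq (by ring)
        _ = (A.card + Fintype.card V * (Fintype.card V : ℝ)⁻¹) *
            (Fintype.card V : ℝ)⁻¹ ^ A.card := by
            rw [Finset.sum_add_distrib, ← Finset.sum_mul]
            simp
            ring
        _ ≤ _ := by
            gcongr
            exact mul_inv_le_one
    calc _ ≤ ∑ x : Fin k → V, ((k : ℝ) + 1) *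
          (Fintype.card V : ℝ)⁻¹ ^ (Finset.univ.image x).card :=
          Finset.sum_le_sum fun x _ => hstep x
      _ ≤ (k + 1) * k.factorial := by
          rw [← Finset.mul_sum]; gcongr
      _ = _ := by rw [Nat.factorial_succ]; push_cast; ring

lemma inv_pow_card_image_le {k : ℕ} (x : Fin k → V) :
    (Fintype.card V : ℝ)⁻¹ ^ (Finset.univ.image x).card * Fintype.card (Equiv.Perm V) ≤
      (Finset.univ.filter fun σ : Equiv.Perm V => ∀ a, σ (x a) = x a).card := by
  classical
  set A := Finset.univ.image x with hA
  have hle : Fintype.card (Equiv.Perm V) ≤ Fintype.card V ^ A.card *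
      (Finset.univ.filter fun σ : Equiv.Perm V => ∀ a, σ (x a) = x a).card := by
    have hcard : Fintype.card (A → V) = Fintype.card V ^ A.card := by simp
    rw [← hcard, ← Finset.card_univ, ← Finset.card_univ (α := A → V), mul_comm]
    refine Finset.card_le_mul_card_image_of_maps_to
      (f := fun (σ : Equiv.Perm V) (a : A) => σ a) (fun _ _ => Finset.mem_univ _) _ ?_
    intro g _
    by_cases hne : ∃ τ : Equiv.Perm V, (fun a : A => τ a) = g
    · obtain ⟨τ, rfl⟩ := hne
      refine Finset.card_le_card_of_injOn (fun σ => τ⁻¹ * σ) ?_ (mul_right_injective _).injOn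
      intro σ hσ
      simp only [Finset.coe_filter, Finset.mem_univ, true_and, Set.mem_ofPred_eq] at hσ ⊢
      intro a
      have := congrFun hσ ⟨x a, by simp [hA]⟩
      simp only at this
      simp [this]
    · push Not at hne
      rw [Finset.filter_false_of_mem fun σ _ => hne σ]
      simp
  rcases Nat.eq_zero_or_pos (Fintype.card V) with h0 | h0
  · have : IsEmpty V := Fintype.card_eq_zero_iff.1 h0
    have hA0 : A = ∅ := Finset.eq_empty_of_isEmpty A
    rw [hA0] at hle ⊢
    simp only [Finset.card_empty, pow_zero, one_mul] at hle ⊢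
    exact_mod_cast hle
  · have h0' : (0 : ℝ) < Fintype.card V := by exact_mod_cast h0
    rw [inv_pow, inv_mul_le_iff₀ (by positivity)]
    exact_mod_cast hle

open Classical in
/-- The expected number of `k`-tuples fixed by a primitive cyclically reduced word is close to the
one for a uniformly random permutation. -/
lemma PrimitiveCycle.sum_card_fixed_le (hc : PrimitiveCycle c ℓ) {k K : ℕ} (hk : 1 ≤ k)
    (hn : k * ℓ + k ≤ K) (hK : 4 * K ^ 2 ≤ Fintype.card V) :
    ∑ x : Fin k → V, ((Finset.univ.filter fun π : α → Equiv.Perm V =>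
        ∀ a, walk c π (x a) ℓ = x a).card : ℝ) ≤
      ((∑ x : Fin k → V, ((Finset.univ.filter fun σ : Equiv.Perm V =>
        ∀ a, σ (x a) = x a).card : ℝ)) / Fintype.card (Equiv.Perm V) +
        k.factorial * (4 * (2 * (K : ℝ) ^ 2) ^ (k + 1) / Fintype.card V)) *
        Fintype.card (α → Equiv.Perm V) := by
  have hP : (0 : ℝ) < Fintype.card (Equiv.Perm V) := by exact_mod_cast Fintype.card_pos
  have hx : ∀ x : Fin k → V, ((Finset.univ.filter fun π : α → Equiv.Perm V =>
        ∀ a, walk c π (x a) ℓ = x a).card : ℝ) ≤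
      ((Fintype.card V : ℝ)⁻¹ ^ (Finset.univ.image x).card *
        (1 + 4 * (2 * (K : ℝ) ^ 2) ^ (k + 1) / Fintype.card V)) *
        Fintype.card (α → Equiv.Perm V) := by
    intro x
    have := hc.card_closed_le_inv_pow (α := α) (Finset.univ.image x)
      ⟨x ⟨0, hk⟩, by simp⟩ (by simpa using Finset.card_image_le (s := Finset.univ) (f := x)) hn hK
    simpa using this
  refine (Finset.sum_le_sum fun x _ => hx x).trans ?_
  rw [← Finset.sum_mul]
  refine mul_le_mul_of_nonneg_right ?_ (by positivity)
  simp only [mul_add, mul_one]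
  rw [Finset.sum_add_distrib, ← Finset.sum_mul, Finset.sum_div]
  refine add_le_add (Finset.sum_le_sum fun x _ => ?_) ?_
  · rw [le_div_iff₀ hP]
    exact inv_pow_card_image_le x
  · exact mul_le_mul_of_nonneg_right (sum_inv_pow_card_image_le k) (by positivity)

end FixedPoints

section Counting

variable {α : Type*} [Fintype α] [DecidableEq α]

open FreeGroup

omit [Fintype α] [DecidableEq α] in
lemma mk_cons_eq_iff (x : α × Bool) (L : List (α × Bool)) (g : FreeGroup α) :
    mk (x :: L) = g ↔ mk L = mk [flip x] * g := by
  have h : mk [flip x] * mk [x] = (1 : FreeGroup α) := by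
    rw [mul_mk, one_eq_mk]
    rcases x with ⟨a, b⟩
    exact Quot.sound (Red.Step.not_rev (L₁ := []) (L₂ := []) (b := b))
  have e : mk (x :: L) = mk [x] * mk L := by rw [mul_mk]; rfl
  rw [e]
  constructor
  · rintro rfl
    rw [← mul_assoc, h, one_mul]
  · intro h'
    rw [h', ← mul_assoc, mul_eq_one_comm.1 h, one_mul]

/-- The radial eigenfunction of the `(q + 1)`-regular tree with eigenvalue `2 √q`. -/
def radial (q : ℝ) (h : ℕ) : ℝ := (1 + (q - 1) / (q + 1) * h) * (√q)⁻¹ ^ h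

lemma radial_nonneg {q : ℝ} (hq : 1 ≤ q) (h : ℕ) : 0 ≤ radial q h := by
  have : 0 ≤ (q - 1) / (q + 1) := div_nonneg (by linarith) (by linarith)
  unfold radial
  positivity

lemma radial_le {q : ℝ} (hq : 1 ≤ q) (h : ℕ) : radial q h ≤ (h + 1) * (√q)⁻¹ ^ h := by
  unfold radial
  have : (q - 1) / (q + 1) ≤ 1 := by rw [div_le_one (by linarith)]; linarith
  have h2 : (q - 1) / (q + 1) * h ≤ 1 * h := by gcongr
  exact mul_le_mul_of_nonneg_right (by linarith) (by positivity)

lemma radial_zero_step {q : ℝ} (hq : 1 ≤ q) : (q + 1) * radial q 1 = 2 * √q * radial q 0 := by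
  have h0 : 0 < √q := Real.sqrt_pos.2 (by linarith)
  have h1 : √q ^ 2 = q := Real.sq_sqrt (by linarith)
  simp only [radial]
  field_simp
  rw [h1]
  push_cast
  ring

lemma radial_step {q : ℝ} (hq : 1 ≤ q) (h : ℕ) :
    radial q h + q * radial q (h + 2) = 2 * √q * radial q (h + 1) := by
  have h0 : 0 < √q := Real.sqrt_pos.2 (by linarith)
  have h1 : √q ^ 2 = q := Real.sq_sqrt (by linarith)
  have h2 : q * (√q)⁻¹ ^ 2 = 1 := by rw [inv_pow, h1]; field_simp
  have h3 : √q * (√q)⁻¹ = 1 := by field_simp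
  simp only [radial]
  generalize (q - 1) / (q + 1) = c
  rw [pow_add _ h 2, pow_succ _ h]
  push_cast
  linear_combination (1 + c * (h + 2)) * (√q)⁻¹ ^ h * h2 -
    2 * (1 + c * (h + 1)) * (√q)⁻¹ ^ h * h3

lemma sum_radial_norm (g : FreeGroup α) {q : ℝ} (hq : 1 ≤ q)
    (hcard : (Fintype.card (α × Bool) : ℝ) = q + 1) :
    ∑ x : α × Bool, radial q (mk [flip x] * g).norm = 2 * √q * radial q g.norm := by
  have hnorm : ∀ x : α × Bool, (mk [flip x] * g).norm = (reduce (flip x :: g.toWord)).length := by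
    intro x
    rw [FreeGroup.norm, ← mk_toWord (x := g), mul_mk, toWord_mk]
    simp
  simp only [hnorm]
  rcases hg : g.toWord with _ | ⟨a, r⟩
  · have : g.norm = 0 := by rw [FreeGroup.norm, hg]; rfl
    rw [this, ← radial_zero_step hq]
    rw [← hcard]
    simp
  · have hn : g.norm = r.length + 1 := by rw [FreeGroup.norm, hg]; rfl
    have hred : reduce (a :: r) = a :: r := by rw [← hg, reduce_toWord]
    have hlen : ∀ x : α × Bool, (reduce (flip x :: a :: r)).length =
        if x = a then r.length else r.length + 2 := by
      intro x
      rw [reduce.cons, hred]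
      rcases x with ⟨x, b⟩; rcases a with ⟨a, b'⟩
      simp only [flip, Prod.mk.injEq]
      cases b <;> cases b' <;> by_cases hxa : x = a <;> simp [hxa]
    simp only [hlen]
    rw [hn, ← radial_step hq]
    rw [← Finset.add_sum_erase _ _ (Finset.mem_univ a), if_pos rfl]
    congr 1
    rw [Finset.sum_congr rfl fun x hx => by rw [if_neg (Finset.ne_of_mem_erase hx)]]
    rw [Finset.sum_const, Finset.card_erase_of_mem (Finset.mem_univ _), Finset.card_univ,
      nsmul_eq_mul, Nat.cast_sub (Fintype.card_pos_iff.2 ⟨a⟩), hcard]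
    simp

/-- The number of words of length `M` representing a given element of the free group. -/
lemma card_words_le (g : FreeGroup α) {q : ℝ} (hq : 1 ≤ q)
    (hcard : (Fintype.card (α × Bool) : ℝ) = q + 1) (M : ℕ) :
    ((Finset.univ.filter fun w : Fin M → α × Bool => mk (List.ofFn w) = g).card : ℝ) ≤
      (2 * √q) ^ M * radial q g.norm := by
  induction M generalizing g with
  | zero =>
    by_cases hg : g = 1
    · subst hg
      rw [FreeGroup.norm_one]
      simp [radial, one_eq_mk]
    · rw [Finset.filter_false_of_mem]
      · simpa using radial_nonneg hq _
      · intro w _ h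
        apply hg
        rw [← h, one_eq_mk]; simp
  | succ M ih =>
    have hsplit : (Finset.univ.filter fun w : Fin (M + 1) → α × Bool => mk (List.ofFn w) = g).card =
        ∑ x : α × Bool, (Finset.univ.filter fun w : Fin M → α × Bool =>
          mk (List.ofFn w) = mk [flip x] * g).card := by
      simp only [Finset.card_filter]
      rw [← (Fin.consEquiv fun _ : Fin (M + 1) => α × Bool).sum_comp, Fintype.sum_prod_type]
      refine Finset.sum_congr rfl fun x _ => Finset.sum_congr rfl fun w _ => ?_
      refine if_congr ?_ rfl rfl
      rw [← mk_cons_eq_iff]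
      simp [Fin.consEquiv, List.ofFn_succ]
    rw [hsplit]
    push_cast
    calc _ ≤ ∑ x : α × Bool, (2 * √q) ^ M * radial q (mk [flip x] * g).norm :=
          Finset.sum_le_sum fun x _ => ih _
      _ = _ := by rw [← Finset.mul_sum, sum_radial_norm g hq hcard]; ring

open Classical in
lemma card_reduced_le {q : ℝ} (hq : 1 ≤ q) (hcard : (Fintype.card (α × Bool) : ℝ) = q + 1)
    (m : ℕ) : ((Finset.univ.filter fun v : Fin m → α × Bool =>
      IsReduced (List.ofFn v)).card : ℝ) ≤ 2 * q ^ m := by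
  cases m with
  | zero =>
    have h1 := Finset.card_filter_le Finset.univ fun v : Fin 0 → α × Bool =>
      IsReduced (List.ofFn v)
    have h2 : ((Finset.univ.filter fun v : Fin 0 → α × Bool =>
      IsReduced (List.ofFn v)).card : ℝ) ≤ 1 := by exact_mod_cast h1
    linarith
  | succ m =>
    suffices h : ((Finset.univ.filter fun v : Fin (m + 1) → α × Bool =>
        IsReduced (List.ofFn v)).card : ℝ) ≤ (q + 1) * q ^ m by
      refine h.trans ?_
      rw [pow_succ]
      nlinarith [pow_pos (by linarith : 0 < q) m]
    induction m with
    | zero =>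
      have := Finset.card_filter_le (Finset.univ) fun v : Fin 1 → α × Bool =>
        IsReduced (List.ofFn v)
      rw [Finset.card_univ] at this
      rw [pow_zero, mul_one, ← hcard]
      have e : Fintype.card (Fin 1 → α × Bool) = Fintype.card (α × Bool) := by
        rw [Fintype.card_fun, Fintype.card_fin, pow_one]
      rw [← e]
      exact_mod_cast this
    | succ m ih =>
      have hq' : ((Fintype.card (α × Bool) - 1 : ℕ) : ℝ) ≤ q := by
        rcases Nat.eq_zero_or_pos (Fintype.card (α × Bool)) with h | h
        · rw [h]; simp; linarith
        · rw [Nat.cast_sub h, hcard]; simp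
      have hsub : (Finset.univ.filter fun v : Fin (m + 2) → α × Bool =>
          IsReduced (List.ofFn v)).card ≤ (Fintype.card (α × Bool) - 1) *
          (Finset.univ.filter fun v : Fin (m + 1) → α × Bool => IsReduced (List.ofFn v)).card := by
        refine Finset.card_le_mul_card_image_of_maps_to
          (f := fun v : Fin (m + 2) → α × Bool => Fin.tail v) ?_ _ ?_
        · intro v hv
          have hv := (Finset.mem_filter.1 hv).2
          refine Finset.mem_filter.2 ⟨Finset.mem_univ _, ?_⟩
          rw [List.ofFn_succ] at hv
          exact List.IsChain.tail hv
        · intro v hv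
          have hcard2 : (Finset.univ.erase (flip (v 0))).card = Fintype.card (α × Bool) - 1 := by
            rw [Finset.card_erase_of_mem (Finset.mem_univ _), Finset.card_univ]
          rw [← hcard2]
          refine Finset.card_le_card_of_injOn (fun w => w 0) ?_ ?_
          · intro w hw
            obtain ⟨hwr, rfl⟩ := Finset.mem_filter.1 (Finset.mem_coe.1 hw)
            have hw := (Finset.mem_filter.1 hwr).2
            refine Finset.mem_coe.2 (Finset.mem_erase.2 ⟨?_, Finset.mem_univ _⟩)
            rw [List.ofFn_succ, List.ofFn_succ, FreeGroup.IsReduced, List.isChain_cons_cons] at hw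
            intro h
            have h1 := hw.1
            simp only [Fin.tail] at h
            rw [h] at h1
            simp [flip] at h1
          · intro w hw w' hw' h
            have hw := (Finset.mem_filter.1 (Finset.mem_coe.1 hw)).2
            have hw' := (Finset.mem_filter.1 (Finset.mem_coe.1 hw')).2
            rw [← Fin.cons_self_tail w, ← Fin.cons_self_tail w', hw, hw']
            simp only at h
            rw [h]
      calc _ ≤ ((Fintype.card (α × Bool) - 1 : ℕ) : ℝ) *
            (Finset.univ.filter fun v : Fin (m + 1) → α × Bool =>
              IsReduced (List.ofFn v)).card := by exact_mod_cast hsub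
        _ ≤ q * ((q + 1) * q ^ m) := by gcongr
        _ = _ := by ring

end Counting

section Imprimitive

variable {α : Type*} [DecidableEq α]

open FreeGroup

/-- The cyclic reduction of an element of the free group. -/
def core (g : FreeGroup α) : List (α × Bool) := reduceCyclically g.toWord

/-- The cyclic reduction of `g` is empty or a nontrivial rotation of itself. -/
def Imprimitive (g : FreeGroup α) : Prop :=
  core g = [] ∨ ∃ t, 0 < t ∧ t < (core g).length ∧ (core g).rotate t = core g

/-- `g` has length `h`, its conjugator has length `j`, its cyclic reduction has period `t`,
and the first half of `g` is `v`. -/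
def HasPeriodData (g : FreeGroup α) (h j t : ℕ) (v : Fin (h / 2) → α × Bool) : Prop :=
  g.toWord.length = h ∧ (reduceCyclically.conjugator g.toWord).length = j ∧
    (t = 0 → core g = []) ∧ 2 * t ≤ (core g).length ∧ (core g).rotate t = core g ∧
    g.toWord.take (h / 2) = List.ofFn v

lemma toWord_eq (g : FreeGroup α) : g.toWord = reduceCyclically.conjugator g.toWord ++ core g ++
    invRev (reduceCyclically.conjugator g.toWord) :=
  (reduceCyclically.conj_conjugator_reduceCyclically _).symm

lemma length_toWord (g : FreeGroup α) : g.toWord.length =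
    2 * (reduceCyclically.conjugator g.toWord).length + (core g).length := by
  conv_lhs => rw [toWord_eq]
  simp
  ring

lemma Imprimitive.exists_hasPeriodData {g : FreeGroup α} (hg : Imprimitive g) :
    ∃ j ≤ g.toWord.length, ∃ t ≤ g.toWord.length, ∃ v,
      HasPeriodData g g.toWord.length j t v ∧ IsReduced (List.ofFn v) := by
  have hlen := length_toWord g
  have key : ∀ t, (t = 0 → core g = []) → 2 * t ≤ (core g).length →
      (core g).rotate t = core g → ∃ j ≤ g.toWord.length, ∃ t ≤ g.toWord.length, ∃ v,
      HasPeriodData g g.toWord.length j t v ∧ IsReduced (List.ofFn v) := by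
    intro t h0 ht hrot
    have htake : (g.toWord.take (g.toWord.length / 2)).length = g.toWord.length / 2 := by
      rw [List.length_take]; omega
    have hv : List.ofFn (fun i : Fin (g.toWord.length / 2) =>
        (g.toWord.take (g.toWord.length / 2))[i]) = g.toWord.take (g.toWord.length / 2) := by
      apply List.ext_getElem
      · simp [htake]
      · intro i h1 h2
        simp
    refine ⟨_, by omega, t, by omega, fun i => (g.toWord.take (g.toWord.length / 2))[i],
      ⟨rfl, rfl, h0, ht, hrot, hv.symm⟩, ?_⟩
    rw [hv]
    exact List.IsChain.take isReduced_toWord _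
  rcases hg with h | ⟨t, h0, ht, hrot⟩
  · exact key 0 (fun _ => h) (by simp) (by simp)
  · rcases Nat.le_total (2 * t) (core g).length with h | h
    · exact key t (by omega) h hrot
    · refine key ((core g).length - t) (by omega) (by omega) ?_
      have hrot2 := congrArg (fun l => l.rotate ((core g).length - t)) hrot
      simp only [List.rotate_rotate] at hrot2
      rw [Nat.add_sub_cancel' ht.le, List.rotate_length] at hrot2
      exact hrot2.symm

lemma eq_of_rotate_eq {β : Type*} {l l' : List β} {t : ℕ} (hlen : l.length = l'.length)
    (h0 : t = 0 → l = []) (h : l.rotate t = l) (h' : l'.rotate t = l')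
    (htake : l.take t = l'.take t) : l = l' := by
  refine List.ext_getElem hlen fun i hi hi' => ?_
  induction i using Nat.strong_induction_on with
  | _ i ih =>
    by_cases hit : i < t
    · have h1 : (l.take t)[i]'(by simp [hit, hi]) = (l'.take t)[i]'(by simp [hit, hi']) := by
        simp only [htake]
      simpa using h1
    · rcases Nat.eq_zero_or_pos t with ht | ht
      · rw [h0 ht] at hi; simp at hi
      · have e : ∀ (m : List β) (hm : m.rotate t = m) (him : i < m.length),
            m[i] = m[i - t]'(by omega) := by
          intro m hm him
          have h1 : (m.rotate t)[i - t]'(by simp; omega) = m[i - t]'(by omega) := by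
            simp only [hm]
          rw [List.getElem_rotate] at h1
          rw [← h1]
          congr 1
          rw [Nat.sub_add_cancel (by omega), Nat.mod_eq_of_lt him]
        rw [e l h hi, e l' h' hi']
        exact ih (i - t) (by omega) _ _

lemma HasPeriodData.unique {g g' : FreeGroup α} {h j t : ℕ} {v : Fin (h / 2) → α × Bool}
    (hg : HasPeriodData g h j t v) (hg' : HasPeriodData g' h j t v) : g = g' := by
  obtain ⟨h1, h2, h3, h4, h5, h6⟩ := hg
  obtain ⟨h1', h2', h3', h4', h5', h6'⟩ := hg'
  have hlen := length_toWord g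
  have hlen' := length_toWord g'
  have htake : ∀ m ≤ h / 2, g.toWord.take m = g'.toWord.take m := by
    intro m hm
    have := congrArg (List.take m) (h6.trans h6'.symm)
    rwa [List.take_take, List.take_take, min_eq_left hm] at this
  have hu : reduceCyclically.conjugator g.toWord = reduceCyclically.conjugator g'.toWord := by
    have := htake j (by omega)
    rw [toWord_eq g, toWord_eq g', List.append_assoc, List.append_assoc,
      List.take_append_of_le_length h2.ge, List.take_append_of_le_length h2'.ge,
      List.take_of_length_le h2.le, List.take_of_length_le h2'.le] at this
    exact this
  have hc : core g = core g' := by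
    refine eq_of_rotate_eq (by omega) h3 h5 h5' ?_
    have := congrArg (List.drop j) (htake (j + t) (by omega))
    have hx : ∀ x : FreeGroup α, (reduceCyclically.conjugator x.toWord).length = j →
        2 * t ≤ (core x).length →
        ((x.toWord.take (j + t)).drop j) = (core x).take t := by
      intro x hx ht
      rw [List.drop_take, Nat.add_sub_cancel_left]
      conv_lhs => rw [toWord_eq]
      rw [List.append_assoc, List.drop_append_of_le_length hx.ge, List.drop_of_length_le hx.le,
        List.nil_append, List.take_append_of_le_length (by omega)]
    rwa [hx g h2 h4, hx g' h2' h4'] at this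
  apply toWord_injective
  rw [toWord_eq g, toWord_eq g', hu, hc]

variable [Fintype α]

open Classical in
/-- There are few words whose cyclic reduction is imprimitive. -/
lemma card_imprimitive_le {q : ℝ} (hq : 1 ≤ q) (hcard : (Fintype.card (α × Bool) : ℝ) = q + 1)
    (M : ℕ) :
    ((Finset.univ.filter fun w : Fin M → α × Bool => Imprimitive (mk (List.ofFn w))).card : ℝ) ≤
      2 * (M + 1) ^ 4 * (2 * √q) ^ M := by
  have h0 : 0 < √q := Real.sqrt_pos.2 (by linarith)
  have hsub : (Finset.univ.filter fun w : Fin M → α × Bool => Imprimitive (mk (List.ofFn w))) ⊆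
      (Finset.range (M + 1)).biUnion fun h => (Finset.range (M + 1)).biUnion fun j =>
        (Finset.range (M + 1)).biUnion fun t =>
          (Finset.univ.filter fun v : Fin (h / 2) → α × Bool => IsReduced (List.ofFn v)).biUnion
            fun v => Finset.univ.filter fun w : Fin M → α × Bool =>
              HasPeriodData (mk (List.ofFn w)) h j t v := by
    intro w hw
    obtain ⟨j, hj, t, ht, v, hv, hr⟩ := (Finset.mem_filter.1 hw).2.exists_hasPeriodData
    have hM : (mk (List.ofFn w)).toWord.length ≤ M := by
      simpa [FreeGroup.norm] using norm_mk_le (L₁ := List.ofFn w)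
    simp only [Finset.mem_biUnion, Finset.mem_range, Finset.mem_filter, Finset.mem_univ, true_and]
    exact ⟨_, by omega, j, by omega, t, by omega, v, hr, hv⟩
  have hone : ∀ h j t (v : Fin (h / 2) → α × Bool),
      ((Finset.univ.filter fun w : Fin M → α × Bool =>
        HasPeriodData (mk (List.ofFn w)) h j t v).card : ℝ) ≤ (2 * √q) ^ M * radial q h := by
    intro h j t v
    rcases (Finset.univ.filter fun w : Fin M → α × Bool =>
        HasPeriodData (mk (List.ofFn w)) h j t v).eq_empty_or_nonempty with he | ⟨w₀, hw₀⟩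
    · rw [he]
      have := radial_nonneg hq h
      simp only [Finset.card_empty, Nat.cast_zero]
      positivity
    · have hw₀ := (Finset.mem_filter.1 hw₀).2
      have := card_words_le (mk (List.ofFn w₀)) hq hcard M
      rw [show (mk (List.ofFn w₀)).norm = h from hw₀.1] at this
      refine le_trans ?_ this
      norm_cast
      refine Finset.card_le_card fun w hw => ?_
      exact Finset.mem_filter.2 ⟨Finset.mem_univ _, (Finset.mem_filter.1 hw).2.unique hw₀⟩
  have hh : ∀ h ≤ M, (2 * q ^ (h / 2)) * ((2 * √q) ^ M * radial q h) ≤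
      2 * (M + 1) * (2 * √q) ^ M := by
    intro h hM
    have h1 := radial_le hq h
    have h2 : q ^ (h / 2) * (√q)⁻¹ ^ h ≤ 1 := by
      rw [inv_pow, mul_inv_le_iff₀ (by positivity), one_mul]
      calc q ^ (h / 2) = √q ^ (2 * (h / 2)) := by
            rw [pow_mul, Real.sq_sqrt (by linarith)]
        _ ≤ √q ^ h := pow_le_pow_right₀ (Real.one_le_sqrt.2 hq) (by omega)
    have h3 : (h : ℝ) ≤ M := by exact_mod_cast hM
    calc _ ≤ (2 * q ^ (h / 2)) * ((2 * √q) ^ M * ((h + 1) * (√q)⁻¹ ^ h)) := by gcongr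
      _ = 2 * (h + 1) * (2 * √q) ^ M * (q ^ (h / 2) * (√q)⁻¹ ^ h) := by ring
      _ ≤ 2 * (h + 1) * (2 * √q) ^ M * 1 := by gcongr
      _ ≤ _ := by rw [mul_one]; gcongr
  calc _ ≤ ∑ h ∈ Finset.range (M + 1), ∑ _j ∈ Finset.range (M + 1), ∑ _t ∈ Finset.range (M + 1),
        2 * ((M : ℝ) + 1) * (2 * √q) ^ M := by
        have h1 := (Finset.card_le_card hsub).trans Finset.card_biUnion_le
        refine le_trans (Nat.cast_le.2 h1) ?_
        push_cast
        refine Finset.sum_le_sum fun h hh' => ?_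
        refine le_trans (Nat.cast_le.2 Finset.card_biUnion_le) ?_
        push_cast
        refine Finset.sum_le_sum fun j _ => ?_
        refine le_trans (Nat.cast_le.2 Finset.card_biUnion_le) ?_
        push_cast
        refine Finset.sum_le_sum fun t _ => ?_
        refine le_trans (Nat.cast_le.2 Finset.card_biUnion_le) ?_
        push_cast
        refine le_trans (Finset.sum_le_sum fun v _ => hone h j t v) ?_
        rw [Finset.sum_const, nsmul_eq_mul]
        have hr := radial_nonneg hq h
        refine le_trans (mul_le_mul_of_nonneg_right (card_reduced_le hq hcard _) (by positivity)) ?_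
        exact hh h (by have := Finset.mem_range.1 hh'; omega)
    _ = _ := by
        simp only [Finset.sum_const, Finset.card_range, nsmul_eq_mul]
        push_cast
        ring

end Imprimitive

lemma sum_card_filter_comm {Ω X : Type*} [Fintype Ω] [Fintype X] (P : Ω → X → Prop)
    [∀ π x, Decidable (P π x)] :
    ∑ π, ((Finset.univ.filter fun x => P π x).card : ℝ) =
      ∑ x, ((Finset.univ.filter fun π => P π x).card : ℝ) := by
  simp only [Finset.card_filter, Nat.cast_sum]
  exact Finset.sum_comm

section Words

variable {α V : Type*}

open FreeGroup

/-- The action of the free group determined by the permutations `π`. -/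
def wordHom (π : α → Equiv.Perm V) : FreeGroup α →* Equiv.Perm V :=
  FreeGroup.lift fun a => (π a)⁻¹

lemma wordHom_mk (π : α → Equiv.Perm V) (L : List (α × Bool)) :
    wordHom π (mk L) = (L.map (act π)).prod := by
  rw [wordHom, lift_mk]
  congr 2
  funext ⟨a, b⟩
  cases b <;> simp [act]

/-- The periodic sequence of letters obtained by reading `l⁻¹` cyclically. -/
def cyclicLetters (l : List (α × Bool)) (hl : 0 < l.length) (i : ℕ) : α × Bool :=
  flip (l[i % l.length]'(Nat.mod_lt _ hl))

lemma walk_cyclicLetters (π : α → Equiv.Perm V) (l : List (α × Bool)) (hl : 0 < l.length) (x : V)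
    (t : ℕ) (ht : t ≤ l.length) :
    walk (cyclicLetters l hl) π x t = (wordHom π (mk (l.take t)))⁻¹ x := by
  induction t with
  | zero => rw [List.take_zero, ← one_eq_mk]; simp [walk]
  | succ t ih =>
    have h1 := ih (by omega)
    have e : l[t % l.length]'(Nat.mod_lt _ hl) = l[t] := by
      congr 1; exact Nat.mod_eq_of_lt ht
    rw [walk, h1, List.take_succ_eq_append_getElem (by omega), cyclicLetters, act_flip, e,
      wordHom_mk, wordHom_mk, List.map_append, List.prod_append, mul_inv_rev]
    simp

variable [DecidableEq α]

lemma primitiveCycle_cyclicLetters {g : FreeGroup α} (hg : ¬ Imprimitive g)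
    (hl : 0 < (core g).length) : PrimitiveCycle (cyclicLetters (core g) hl) (core g).length where
  length_pos := hl
  periodic i := by simp [cyclicLetters]
  reduced i := by
    have hcyc : IsCyclicallyReduced (core g) :=
      reduceCyclically.isCyclicallyReduced isReduced_toWord
    have hne : core g ≠ [] := List.length_pos_iff.1 hl
    have key : ∀ a b : α × Bool, (a.1 = b.1 → a.2 = b.2) → flip b ≠ a := by
      rintro ⟨a, x⟩ ⟨b, y⟩ h h'
      simp only [flip, Prod.mk.injEq] at h' h
      have := h h'.1.symm
      rw [← this] at h'
      simp at h'
    rw [cyclicLetters, cyclicLetters, flip_flip]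
    apply key
    by_cases h : i % (core g).length + 1 < (core g).length
    · have h2 : (i + 1) % (core g).length = i % (core g).length + 1 := by
        rw [Nat.add_mod, Nat.mod_eq_of_lt (a := 1) (by omega), Nat.mod_eq_of_lt h]
      simp only [h2]
      exact List.isChain_iff_getElem.1 hcyc.1 _ h
    · have h3 : i % (core g).length = (core g).length - 1 := by
        have := Nat.mod_lt i hl; omega
      have h2 : (i + 1) % (core g).length = 0 := by
        rw [← Nat.mod_add_mod, h3, Nat.sub_add_cancel hl, Nat.mod_self]
      simp only [h2, h3]
      refine hcyc.2 _ ?_ _ ?_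
      · rw [List.getLast?_eq_getElem?, Option.mem_def, List.getElem?_eq_getElem]
      · rw [List.head?_eq_getElem?, Option.mem_def, List.getElem?_eq_getElem]
  primitive τ h0 hτ := by
    by_contra h
    push Not at h
    refine hg (Or.inr ⟨τ, h0, hτ, ?_⟩)
    refine List.ext_getElem (by simp) fun i h1 h2 => ?_
    have := congrArg flip (h i)
    simp only [cyclicLetters, flip_flip] at this
    rw [List.getElem_rotate, this]
    congr 1
    exact Nat.mod_eq_of_lt h2

variable [Fintype α] [Fintype V] [DecidableEq V]

open Classical in
/-- The expected number of `k`-tuples fixed by a word. -/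
lemma sum_card_fixed_le {g : FreeGroup α} (hg : ¬ Imprimitive g) {k K : ℕ} (hk : 1 ≤ k)
    (hn : k * g.toWord.length + k ≤ K) (hK : 4 * K ^ 2 ≤ Fintype.card V) :
    ∑ π : α → Equiv.Perm V, ((Finset.univ.filter fun x : Fin k → V =>
        ∀ a, wordHom π g (x a) = x a).card : ℝ) ≤
      ((∑ σ : Equiv.Perm V, ((Finset.univ.filter fun x : Fin k → V =>
        ∀ a, σ (x a) = x a).card : ℝ)) / Fintype.card (Equiv.Perm V) +
        k.factorial * (4 * (2 * (K : ℝ) ^ 2) ^ (k + 1) / Fintype.card V)) *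
        Fintype.card (α → Equiv.Perm V) := by
  have hl : 0 < (core g).length := by
    rw [List.length_pos_iff]
    exact fun h => hg (Or.inl h)
  have hc := primitiveCycle_cyclicLetters hg hl
  have hlen : k * (core g).length + k ≤ K := by
    have h1 := length_toWord g
    have h2 : k * (core g).length ≤ k * g.toWord.length := Nat.mul_le_mul_left _ (by omega)
    omega
  have main := hc.sum_card_fixed_le (V := V) hk hlen hK
  rw [sum_card_filter_comm fun (σ : Equiv.Perm V) (x : Fin k → V) => ∀ a, σ (x a) = x a]
  refine le_trans (le_of_eq ?_) main
  rw [← sum_card_filter_comm fun (π : α → Equiv.Perm V) (x : Fin k → V) =>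
    ∀ a, walk (cyclicLetters (core g) hl) π (x a) (core g).length = x a]
  refine Finset.sum_congr rfl fun π _ => ?_
  congr 1
  set u := wordHom π (mk (reduceCyclically.conjugator g.toWord)) with hu
  have hconj : wordHom π g = u * wordHom π (mk (core g)) * u⁻¹ := by
    conv_lhs => rw [← mk_toWord (x := g), toWord_eq g, ← mul_mk, ← mul_mk, ← inv_mk]
    rw [_root_.map_mul, _root_.map_mul, _root_.map_inv]
  refine Finset.card_bij' (fun x _ a => u⁻¹ (x a)) (fun x _ a => u (x a)) ?_ ?_ ?_ ?_
  · intro x hx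
    simp only [Finset.mem_filter, Finset.mem_univ, true_and] at hx ⊢
    intro a
    rw [walk_cyclicLetters _ _ _ _ _ le_rfl, List.take_length, Equiv.Perm.inv_eq_iff_eq]
    have := hx a
    rw [hconj, Equiv.Perm.mul_apply, Equiv.Perm.mul_apply] at this
    exact (Equiv.Perm.inv_eq_iff_eq.2 this.symm)
  · intro x hx
    simp only [Finset.mem_filter, Finset.mem_univ, true_and] at hx ⊢
    intro a
    have := hx a
    rw [walk_cyclicLetters _ _ _ _ _ le_rfl, List.take_length, Equiv.Perm.inv_eq_iff_eq] at this
    rw [hconj, Equiv.Perm.mul_apply, Equiv.Perm.mul_apply]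
    simp [← this]
  · intro x _; simp
  · intro x _; simp

end Words

section Norms

open scoped Matrix.Norms.L2Operator

variable {n : Type*} [Fintype n] [DecidableEq n]

lemma norm_sq_le_trace (B : Matrix n n ℂ) : ‖B‖ ^ 2 ≤ (Bᴴ * B).trace.re := by
  have htr : (Bᴴ * B).trace.re = ∑ i, ∑ j, ‖B i j‖ ^ 2 := by
    rw [Finset.sum_comm]
    simp only [Matrix.trace, Matrix.diag_apply, Matrix.mul_apply, Matrix.conjTranspose_apply,
      Complex.re_sum]
    refine Finset.sum_congr rfl fun j _ => Finset.sum_congr rfl fun i _ => ?_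
    rw [Complex.star_def, ← Complex.normSq_eq_conj_mul_self, Complex.ofReal_re,
      Complex.normSq_eq_norm_sq]
  have hnn : 0 ≤ ∑ i, ∑ j, ‖B i j‖ ^ 2 := by positivity
  rw [htr]
  refine (Real.le_sqrt (norm_nonneg _) hnn).1 ?_
  rw [Matrix.cstar_norm_def]
  refine ContinuousLinearMap.opNorm_le_bound _ (Real.sqrt_nonneg _) fun x => ?_
  rw [← abs_of_nonneg (norm_nonneg (Matrix.toEuclideanCLM (𝕜 := ℂ) B x)),
    ← Real.sqrt_sq_eq_abs, ← abs_of_nonneg (norm_nonneg x), ← Real.sqrt_sq_eq_abs,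
    ← Real.sqrt_mul hnn]
  refine Real.sqrt_le_sqrt ?_
  rw [EuclideanSpace.norm_sq_eq, EuclideanSpace.norm_sq_eq, Finset.sum_mul]
  refine Finset.sum_le_sum fun i _ => ?_
  rw [Matrix.ofLp_toEuclideanCLM]
  calc ‖(B *ᵥ x.ofLp) i‖ ^ 2 ≤ (∑ j, ‖B i j‖ * ‖x j‖) ^ 2 := by
        gcongr
        refine (norm_sum_le _ _).trans (le_of_eq ?_)
        simp
    _ ≤ _ := Finset.sum_mul_sq_le_sq_mul_sq _ _ _

lemma norm_pow_le_of_isHermitian {H : Matrix n n ℂ} (hH : H.IsHermitian) {p : ℕ} (hp : 1 ≤ p) :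
    ‖H‖ ^ p ≤ ‖H ^ p‖ := by
  rcases (norm_nonneg H).eq_or_lt with h0 | h0
  · rw [← h0, zero_pow (by omega)]; exact norm_nonneg _
  have h1 := IsSelfAdjoint.norm_pow_two_pow (show IsSelfAdjoint H from hH) p
  have hlt : p < 2 ^ p := Nat.lt_two_pow_self
  have h2 : ‖H ^ 2 ^ p‖ ≤ ‖H ^ p‖ * ‖H‖ ^ (2 ^ p - p) := by
    have : H ^ 2 ^ p = H ^ p * H ^ (2 ^ p - p) := by rw [← pow_add]; congr 1; omega
    rw [this]
    refine (norm_mul_le _ _).trans ?_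
    gcongr
    exact norm_pow_le' _ (by omega)
  rw [h1] at h2
  have h3 : ‖H‖ ^ 2 ^ p = ‖H‖ ^ p * ‖H‖ ^ (2 ^ p - p) := by rw [← pow_add]; congr 1; omega
  rw [h3] at h2
  exact le_of_mul_le_mul_right h2 (by positivity)

lemma opNorm_pow_le_trace {H : Matrix n n ℂ} (hH : H.IsHermitian) {p : ℕ} (hp : 1 ≤ p) :
    opNorm H ^ (2 * p) ≤ (H ^ (2 * p)).trace.re := by
  have h1 := norm_sq_le_trace (H ^ p)
  rw [(hH.pow p).eq, ← pow_add, ← two_mul] at h1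
  refine le_trans ?_ h1
  rw [mul_comm, pow_mul]
  have := norm_pow_le_of_isHermitian hH hp
  have h0 : 0 ≤ ‖H‖ ^ p := by positivity
  exact pow_le_pow_left₀ h0 this 2

end Norms

section Representation

variable {N k : ℕ}

/-- The `k`-fold tensor power of the permutation representation. -/
def rep (k : ℕ) (π : Equiv.Perm (Fin N)) : Matrix (Fin k → Fin N) (Fin k → Fin N) ℂ :=
  tensorPow (permMat N π) k

lemma rep_apply (π : Equiv.Perm (Fin N)) (i j : Fin k → Fin N) :
    rep k π i j = if i = fun a => π (j a) then 1 else 0 := by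
  simp only [rep, tensorPow, permMat, Matrix.of_apply, Finset.prod_ite_zero, Finset.prod_const_one,
    funext_iff, Finset.mem_univ, true_implies, eq_comm]

lemma rep_mul (π σ : Equiv.Perm (Fin N)) : rep k (π * σ) = rep k π * rep k σ := by
  ext i j
  simp only [Matrix.mul_apply, rep_apply, mul_ite, mul_one, mul_zero, Finset.sum_ite_eq',
    Finset.mem_univ, if_true, Equiv.Perm.mul_apply]
  exact if_congr Iff.rfl rfl rfl

lemma rep_one : rep k (1 : Equiv.Perm (Fin N)) = 1 := by
  ext i j
  rw [rep_apply, Matrix.one_apply]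
  exact if_congr Iff.rfl rfl rfl

lemma rep_inv (π : Equiv.Perm (Fin N)) : rep k π⁻¹ = (rep k π)ᴴ := by
  ext i j
  have : (i = fun a => π⁻¹ (j a)) ↔ j = fun a => π (i a) := by
    simp only [funext_iff, Equiv.Perm.eq_inv_iff_eq, eq_comm]
  rw [Matrix.conjTranspose_apply, rep_apply, rep_apply, if_congr this rfl rfl, apply_ite star,
    star_one, star_zero]

lemma rep_list_prod (l : List (Equiv.Perm (Fin N))) :
    rep k l.prod = (l.map (rep k)).prod := by
  induction l with
  | nil => simp [rep_one]
  | cons a l ih => simp [rep_mul, ih]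

lemma trace_rep (π : Equiv.Perm (Fin N)) : (rep k π).trace =
    ((Finset.univ.filter fun x : Fin k → Fin N => ∀ a, π (x a) = x a).card : ℂ) := by
  simp only [Matrix.trace, Matrix.diag_apply, rep_apply, Finset.sum_boole]
  congr 3
  ext x
  simp only [funext_iff, eq_comm]

lemma Pik_eq : Pik N k = ((N.factorial : ℂ))⁻¹ • ∑ π : Equiv.Perm (Fin N), rep k π := rfl

lemma rep_mul_Pik (π : Equiv.Perm (Fin N)) : rep k π * Pik N k = Pik N k := by
  rw [Pik_eq, mul_smul_comm, Finset.mul_sum]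
  simp only [← rep_mul]
  exact congrArg _ (Fintype.sum_equiv (Equiv.mulLeft π) _ _ fun _ => rfl)

lemma Pik_mul_rep (π : Equiv.Perm (Fin N)) : Pik N k * rep k π = Pik N k := by
  rw [Pik_eq, smul_mul_assoc, Finset.sum_mul]
  simp only [← rep_mul]
  exact congrArg _ (Fintype.sum_equiv (Equiv.mulRight π) _ _ fun _ => rfl)

lemma Pik_mul_Pik : Pik N k * Pik N k = Pik N k := by
  conv_lhs => rw [Pik_eq, smul_mul_assoc, Finset.sum_mul, ← Pik_eq]
  simp only [rep_mul_Pik]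
  rw [Finset.sum_const, Finset.card_univ, Fintype.card_perm, Fintype.card_fin,
    ← Nat.cast_smul_eq_nsmul ℂ, smul_smul, inv_mul_cancel₀ (by exact_mod_cast N.factorial_ne_zero),
    one_smul]

lemma isHermitian_Pik : (Pik N k).IsHermitian := by
  rw [Matrix.IsHermitian, Pik_eq, Matrix.conjTranspose_smul, Matrix.conjTranspose_sum]
  simp only [← rep_inv]
  exact congrArg₂ _ (by simp) (Fintype.sum_equiv (Equiv.inv _) _ _ fun _ => rfl)

variable {D : ℕ} (π : Fin (D / 2) → Equiv.Perm (Fin N))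

lemma LkHalf_eq : LkHalf N D k π =
    (D : ℂ)⁻¹ • ∑ p : Fin (D / 2) × Bool, rep k (act π p) := by
  simp only [LkHalf, rep, act, apply_ite]

lemma isHermitian_LkHalf : (LkHalf N D k π).IsHermitian := by
  rw [Matrix.IsHermitian, LkHalf_eq, Matrix.conjTranspose_smul, Matrix.conjTranspose_sum]
  simp only [← rep_inv, ← act_flip]
  exact congrArg₂ _ (by simp)
    (Fintype.sum_equiv (Function.Involutive.toPerm flip flip_flip) _ _ fun _ => rfl)

lemma card_letters (hD : 2 ≤ D) (hDeven : Even D) : Fintype.card (Fin (D / 2) × Bool) = D := by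
  obtain ⟨r, rfl⟩ := hDeven
  simp; omega

lemma LkHalf_mul_Pik (hD : 2 ≤ D) (hDeven : Even D) :
    LkHalf N D k π * Pik N k = Pik N k := by
  rw [LkHalf_eq, smul_mul_assoc, Finset.sum_mul]
  simp only [rep_mul_Pik]
  rw [Finset.sum_const, Finset.card_univ, card_letters hD hDeven, ← Nat.cast_smul_eq_nsmul ℂ,
    smul_smul, inv_mul_cancel₀ (by norm_cast; omega), one_smul]

lemma Pik_mul_LkHalf (hD : 2 ≤ D) (hDeven : Even D) :
    Pik N k * LkHalf N D k π = Pik N k := by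
  rw [LkHalf_eq, mul_smul_comm, Finset.mul_sum]
  simp only [Pik_mul_rep]
  rw [Finset.sum_const, Finset.card_univ, card_letters hD hDeven, ← Nat.cast_smul_eq_nsmul ℂ,
    smul_smul, inv_mul_cancel₀ (by norm_cast; omega), one_smul]

lemma sub_Pik_pow (hD : 2 ≤ D) (hDeven : Even D) (M : ℕ) :
    (LkHalf N D k π - Pik N k) ^ (M + 1) = LkHalf N D k π ^ (M + 1) - Pik N k := by
  induction M with
  | zero => simp
  | succ M ih =>
    have h : LkHalf N D k π ^ (M + 1) * Pik N k = Pik N k := by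
      clear ih
      induction M with
      | zero => simpa using LkHalf_mul_Pik π hD hDeven
      | succ M ih => rw [pow_succ, mul_assoc, LkHalf_mul_Pik π hD hDeven, ih]
    rw [pow_succ, ih, sub_mul, mul_sub, mul_sub, ← pow_succ, h, Pik_mul_LkHalf π hD hDeven,
      Pik_mul_Pik]
    simp

lemma sum_pow_eq_sum_prod {R ι : Type*} [Semiring R] [Fintype ι] (A : ι → R) (M : ℕ) :
    (∑ i, A i) ^ M = ∑ w : Fin M → ι, ((List.ofFn w).map A).prod := by
  induction M with
  | zero => simp
  | succ M ih =>
    rw [pow_succ', ih, Finset.sum_mul_sum, ← (Fin.consEquiv fun _ => ι).sum_comp,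
      Fintype.sum_prod_type]
    simp [Fin.consEquiv, List.ofFn_succ]

lemma trace_LkHalf_pow (M : ℕ) : (LkHalf N D k π ^ M).trace =
    ((D : ℂ)⁻¹) ^ M * ∑ w : Fin M → Fin (D / 2) × Bool,
      ((Finset.univ.filter fun x : Fin k → Fin N =>
        ∀ a, wordHom π (FreeGroup.mk (List.ofFn w)) (x a) = x a).card : ℂ) := by
  rw [LkHalf_eq, smul_pow, sum_pow_eq_sum_prod, Matrix.trace_smul, Matrix.trace_sum, smul_eq_mul]
  congr 1
  refine Finset.sum_congr rfl fun w _ => ?_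
  rw [← trace_rep, wordHom_mk, rep_list_prod, List.map_map]
  rfl

lemma trace_Pik : (Pik N k).trace = ((N.factorial : ℂ))⁻¹ * ∑ σ : Equiv.Perm (Fin N),
    ((Finset.univ.filter fun x : Fin k → Fin N => ∀ a, σ (x a) = x a).card : ℂ) := by
  rw [Pik_eq, Matrix.trace_smul, Matrix.trace_sum, smul_eq_mul]
  simp only [trace_rep]

lemma opNorm_sub_pow_le (hD : 2 ≤ D) (hDeven : Even D) {p : ℕ} (hp : 1 ≤ p) :
    opNorm (LkHalf N D k π - Pik N k) ^ (2 * p) ≤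
      ((D : ℝ)⁻¹) ^ (2 * p) * ∑ w : Fin (2 * p) → Fin (D / 2) × Bool,
        ((Finset.univ.filter fun x : Fin k → Fin N =>
          ∀ a, wordHom π (FreeGroup.mk (List.ofFn w)) (x a) = x a).card : ℝ) -
      (∑ σ : Equiv.Perm (Fin N),
        ((Finset.univ.filter fun x : Fin k → Fin N => ∀ a, σ (x a) = x a).card : ℝ)) /
        Fintype.card (Equiv.Perm (Fin N)) := by
  refine (opNorm_pow_le_trace ((isHermitian_LkHalf π).sub isHermitian_Pik) hp).trans (le_of_eq ?_)
  have h := sub_Pik_pow (k := k) π hD hDeven (2 * p - 1)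
  rw [Nat.sub_add_cancel (by omega)] at h
  rw [h, Matrix.trace_sub, trace_LkHalf_pow, trace_Pik, Fintype.card_perm, Fintype.card_fin,
    Complex.sub_re, div_eq_inv_mul]
  congr 1
  · rw [← Complex.ofReal_re (_ * _)]
    push_cast
    rfl
  · rw [← Complex.ofReal_re (_ * _)]
    push_cast
    rfl

open scoped Matrix.Norms.L2Operator in
lemma opNorm_sub_le (hD : 2 ≤ D) (hDeven : Even D) : opNorm (LkHalf N D k π - Pik N k) ≤ 2 := by
  have hrep : ∀ σ : Equiv.Perm (Fin N), ‖rep k σ‖ ≤ 1 := by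
    intro σ
    have h1 := Matrix.l2_opNorm_conjTranspose_mul_self (rep k σ)
    rw [← rep_inv, ← rep_mul, inv_mul_cancel, rep_one] at h1
    rcases subsingleton_or_nontrivial (Matrix (Fin k → Fin N) (Fin k → Fin N) ℂ) with h | h
    · rw [Subsingleton.elim (rep k σ) 0]; simp
    · rw [CStarRing.norm_one] at h1
      nlinarith [norm_nonneg (rep k σ)]
  have key : ∀ {ι : Type} [Fintype ι] (f : ι → Equiv.Perm (Fin N)) (d : ℕ), 0 < d →
      Fintype.card ι = d → ‖(d : ℂ)⁻¹ • ∑ i, rep k (f i)‖ ≤ 1 := by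
    intro ι _ f d hd hcard
    rw [norm_smul, norm_inv, Complex.norm_natCast]
    have : ‖∑ i, rep k (f i)‖ ≤ d := by
      refine (norm_sum_le _ _).trans ((Finset.sum_le_sum fun i _ => hrep (f i)).trans ?_)
      simp [hcard]
    have hd' : (0 : ℝ) < d := by exact_mod_cast hd
    rw [inv_mul_le_iff₀ hd']
    simpa using this
  have h1 : ‖LkHalf N D k π‖ ≤ 1 := by
    rw [LkHalf_eq]
    exact key _ D (by omega) (card_letters hD hDeven)
  have h2 : ‖Pik N k‖ ≤ 1 := by
    rw [Pik_eq]
    exact key id _ N.factorial_pos (by simp [Fintype.card_perm])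
  refine (norm_sub_le (LkHalf N D k π) (Pik N k)).trans ?_
  linarith

end Representation

open Classical in
/-- The high even moments of the nontrivial spectral radius. -/
lemma sum_opNorm_pow_le {N D k p : ℕ} (hD : 4 ≤ D) (hDeven : Even D) (hN : 1 ≤ N) (hk : 1 ≤ k)
    (hp : 1 ≤ p) (hK : 4 * (2 * k * (2 * p)) ^ 2 ≤ N) :
    ∑ π : Fin (D / 2) → Equiv.Perm (Fin N), opNorm (LkHalf N D k π - Pik N k) ^ (2 * p) ≤
      (k.factorial * (4 * (2 * (2 * k * (2 * p) : ℝ) ^ 2) ^ (k + 1) / N) +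
        (N : ℝ) ^ k * (2 * (2 * p + 1) ^ 4 * lamH D ^ (2 * p))) *
        Fintype.card (Fin (D / 2) → Equiv.Perm (Fin N)) := by
  set M := 2 * p with hM
  set F : (Fin M → Fin (D / 2) × Bool) → (Fin (D / 2) → Equiv.Perm (Fin N)) → ℝ := fun w π =>
    ((Finset.univ.filter fun x : Fin k → Fin N =>
      ∀ a, wordHom π (FreeGroup.mk (List.ofFn w)) (x a) = x a).card : ℝ) with hF
  set T : ℝ := (∑ σ : Equiv.Perm (Fin N),
    ((Finset.univ.filter fun x : Fin k → Fin N => ∀ a, σ (x a) = x a).card : ℝ)) /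
      Fintype.card (Equiv.Perm (Fin N)) with hT
  set Ω : ℝ := (Fintype.card (Fin (D / 2) → Equiv.Perm (Fin N)) : ℝ) with hΩ
  set E : ℝ := k.factorial * (4 * (2 * (2 * k * (2 * p) : ℝ) ^ 2) ^ (k + 1) / N) with hE
  have hT0 : 0 ≤ T :=
    div_nonneg (Finset.sum_nonneg fun _ _ => Nat.cast_nonneg _) (Nat.cast_nonneg _)
  have hE0 : 0 ≤ E := by positivity
  have hΩ0 : 0 ≤ Ω := Nat.cast_nonneg _
  have hD0 : (0 : ℝ) < D := by exact_mod_cast (by omega : 0 < D)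
  have hword : ∀ w, ∑ π, F w π ≤ (T + E) * Ω +
      if Imprimitive (FreeGroup.mk (List.ofFn w)) then (N : ℝ) ^ k * Ω else 0 := by
    intro w
    split_ifs with h
    · have : ∑ π, F w π ≤ (N : ℝ) ^ k * Ω := by
        calc ∑ π, F w π ≤ ∑ _π : Fin (D / 2) → Equiv.Perm (Fin N), (N : ℝ) ^ k := by
              refine Finset.sum_le_sum fun π _ => ?_
              have := Finset.card_le_univ (Finset.univ.filter fun x : Fin k → Fin N =>
                ∀ a, wordHom π (FreeGroup.mk (List.ofFn w)) (x a) = x a)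
              rw [Fintype.card_fun, Fintype.card_fin, Fintype.card_fin] at this
              simp only [hF]
              exact_mod_cast this
          _ = _ := by rw [Finset.sum_const, Finset.card_univ, nsmul_eq_mul, mul_comm]
      have := mul_nonneg (add_nonneg hT0 hE0) hΩ0
      linarith
    · rw [add_zero]
      have hlen : (FreeGroup.mk (List.ofFn w)).toWord.length ≤ M := by
        have := FreeGroup.norm_mk_le (L₁ := List.ofFn w)
        rwa [List.length_ofFn] at this
      have h1 := sum_card_fixed_le (V := Fin N) h (K := 2 * k * M) hk (by nlinarith)
        (by simpa using hK)
      simp only [Fintype.card_fin] at h1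
      convert h1 using 3
      rw [hE, hM]
      push_cast
      rfl
  have hbad := card_imprimitive_le (α := Fin (D / 2)) (q := (D : ℝ) - 1)
    (by have : (4 : ℝ) ≤ D := by exact_mod_cast hD
        linarith)
    (by rw [card_letters (by omega) hDeven]; ring) M
  set b : ℝ := ((Finset.univ.filter fun w : Fin M → Fin (D / 2) × Bool =>
    Imprimitive (FreeGroup.mk (List.ofFn w))).card : ℝ) with hb
  calc _ ≤ ∑ π, (((D : ℝ)⁻¹) ^ M * ∑ w, F w π - T) :=
        Finset.sum_le_sum fun π _ => opNorm_sub_pow_le π (by omega) hDeven hp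
    _ = ((D : ℝ)⁻¹) ^ M * ∑ w, ∑ π, F w π - Ω * T := by
        rw [Finset.sum_sub_distrib, ← Finset.mul_sum, Finset.sum_comm, Finset.sum_const,
          Finset.card_univ, nsmul_eq_mul]
    _ ≤ ((D : ℝ)⁻¹) ^ M * ((D : ℝ) ^ M * ((T + E) * Ω) + b * ((N : ℝ) ^ k * Ω)) - Ω * T := by
        gcongr
        refine (Finset.sum_le_sum fun w _ => hword w).trans (le_of_eq ?_)
        rw [Finset.sum_add_distrib, Finset.sum_const, Finset.card_univ, Fintype.card_fun,
          Fintype.card_fin, card_letters (by omega) hDeven, ← Finset.sum_filter, Finset.sum_const,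
          nsmul_eq_mul, nsmul_eq_mul]
        push_cast
        rfl
    _ = (E + (N : ℝ) ^ k * (((D : ℝ)⁻¹) ^ M * b)) * Ω := by
        have : ((D : ℝ)⁻¹) ^ M * (D : ℝ) ^ M = 1 := by
          rw [← mul_pow, inv_mul_cancel₀ hD0.ne', one_pow]
        linear_combination ((T + E) * Ω) * this
    _ ≤ _ := by
        refine mul_le_mul_of_nonneg_right (add_le_add_right
          (mul_le_mul_of_nonneg_left ?_ (by positivity)) _) hΩ0
        calc ((D : ℝ)⁻¹) ^ M * b ≤
              ((D : ℝ)⁻¹) ^ M * (2 * (M + 1) ^ 4 * (2 * √((D : ℝ) - 1)) ^ M) := by gcongr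
          _ = _ := by
              rw [lamH, div_eq_inv_mul, mul_pow ((D : ℝ)⁻¹), hM]
              push_cast
              ring

lemma exp_half_le_one_add {t : ℝ} (h0 : 0 ≤ t) (h2 : t ≤ 2) : Real.exp (t / 2) ≤ 1 + t := by
  rw [← Real.le_log_iff_exp_le (by linarith)]
  refine le_trans ?_ (Real.le_log_one_add_of_nonneg h0)
  rw [div_le_div_iff₀ (by norm_num) (by linarith)]
  nlinarith

/-- The moment bound in terms of `y ≥ (4kp) ^ (1/3)`. -/
lemma moment_bound_le {N y lam : ℝ} {k p : ℕ} (hN : 0 < N) (hk : 1 ≤ k) (hp : 1 ≤ p)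
    (hlam : N ^ k * lam ^ (2 * p) ≤ 1 / N) (hy : 16 ≤ y) (hKy : 2 * k * (2 * p) ≤ y ^ 3) :
    k.factorial * (4 * (2 * (2 * k * (2 * p) : ℝ) ^ 2) ^ (k + 1) / N) +
      N ^ k * (2 * (2 * p + 1) ^ 4 * lam ^ (2 * p)) ≤ (y ^ 10) ^ (k + 1) / N := by
  have hkR : (1 : ℝ) ≤ k := by exact_mod_cast hk
  have hpR : (1 : ℝ) ≤ p := by exact_mod_cast hp
  have hK1 : (1 : ℝ) ≤ 2 * k * (2 * p) := by nlinarith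
  have hkK : (k : ℝ) ≤ 2 * k * (2 * p) := by nlinarith
  have hpK : 2 * (p : ℝ) + 1 ≤ 2 * k * (2 * p) := by nlinarith
  generalize (2 * k * (2 * p) : ℝ) = K at *
  have hfac : (k.factorial : ℝ) ≤ K ^ (k + 1) := by
    calc (k.factorial : ℝ) ≤ (k : ℝ) ^ k := by exact_mod_cast Nat.factorial_le_pow k
      _ ≤ K ^ k := by gcongr
      _ ≤ K ^ (k + 1) := pow_le_pow_right₀ hK1 (by omega)
  have hfirst : k.factorial * (4 * (2 * K ^ 2) ^ (k + 1) / N) ≤ (8 * K ^ 3) ^ (k + 1) / N := by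
    have h4 : (4 : ℝ) ≤ 4 ^ (k + 1) := le_self_pow₀ (by norm_num) (by omega)
    calc k.factorial * (4 * (2 * K ^ 2) ^ (k + 1) / N)
        ≤ K ^ (k + 1) * (4 ^ (k + 1) * (2 * K ^ 2) ^ (k + 1) / N) := by gcongr
      _ = (8 * K ^ 3) ^ (k + 1) / N := by
          rw [← mul_pow, ← mul_div_assoc, ← mul_pow]
          ring_nf
  have hsecond : N ^ k * (2 * (2 * p + 1) ^ 4 * lam ^ (2 * p)) ≤ (8 * K ^ 3) ^ (k + 1) / N := by
    calc N ^ k * (2 * (2 * p + 1) ^ 4 * lam ^ (2 * p))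
        = 2 * (2 * p + 1) ^ 4 * (N ^ k * lam ^ (2 * p)) := by ring
      _ ≤ 2 * K ^ 4 * (1 / N) := by
          have := (even_two_mul p).pow_nonneg lam
          gcongr
      _ ≤ (8 * K ^ 3) ^ 2 * (1 / N) := by
          gcongr
          have : K ^ 4 ≤ K ^ 6 := pow_le_pow_right₀ hK1 (by norm_num)
          have : 0 < K ^ 6 := by positivity
          rw [mul_pow, ← pow_mul]
          norm_num
          linarith
      _ ≤ (8 * K ^ 3) ^ (k + 1) * (1 / N) := by
          gcongr
          · linarith [one_le_pow₀ hK1 (n := 3)]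
          · omega
      _ = _ := by ring
  have hsum : 2 * (8 * K ^ 3) ^ (k + 1) ≤ (16 * K ^ 3) ^ (k + 1) := by
    have : (16 * K ^ 3) ^ (k + 1) = 2 ^ (k + 1) * (8 * K ^ 3) ^ (k + 1) := by
      rw [← mul_pow]; ring_nf
    rw [this]
    gcongr
    exact le_self_pow₀ (by norm_num) (by omega)
  calc _ ≤ (8 * K ^ 3) ^ (k + 1) / N + (8 * K ^ 3) ^ (k + 1) / N := add_le_add hfirst hsecond
    _ = 2 * (8 * K ^ 3) ^ (k + 1) / N := by ring
    _ ≤ (16 * K ^ 3) ^ (k + 1) / N := by gcongr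
    _ ≤ (y * (y ^ 3) ^ 3) ^ (k + 1) / N := by gcongr
    _ = _ := by ring_nf

lemma exp_le_threshold_pow {k p : ℕ} {β n s C : ℝ} (hk : 1 ≤ k) (hβ : 0 < β) (hn : 0 < n)
    (hs : β ≤ s) (hC : 22 * β ≤ C) (ht : C * s / n ≤ 2) (hp : (k + 1) * n / β ≤ 2 * p)
    (hp2 : 2 * p ≤ (k + 1) * n / β + 2) :
    Real.exp (10 * (k + 1) * s - n) ≤ (Real.exp (-β / (k + 1)) + C * s / n) ^ (2 * p) := by
  have hkR : (1 : ℝ) ≤ k := by exact_mod_cast hk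
  have hs0 : 0 < s := hβ.trans_le hs
  have hC0 : 0 < C := by linarith
  have hle1 : Real.exp (-β / (k + 1)) ≤ 1 := by
    rw [Real.exp_le_one_iff]
    exact div_nonpos_of_nonpos_of_nonneg (by linarith) (by linarith)
  have e2 : 11 * (k + 1) * s ≤ (2 * p : ℝ) * (C * s / n / 2) := by
    calc 11 * (k + 1) * s = (22 * β) * ((k + 1) * n / β * s / (2 * n)) := by
          field_simp; ring
      _ ≤ C * ((k + 1) * n / β * s / (2 * n)) := by gcongr
      _ = (k + 1) * n / β * (C * s / n / 2) := by field_simp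
      _ ≤ _ := by gcongr
  have ht0 : 0 ≤ C * s / n := by positivity
  generalize C * s / n = t at *
  have e1 : (2 * p : ℝ) * (β / (k + 1)) ≤ n + β := by
    calc (2 * p : ℝ) * (β / (k + 1)) ≤ ((k + 1) * n / β + 2) * (β / (k + 1)) := by gcongr
      _ = n + β * (2 / (k + 1)) := by field_simp
      _ ≤ n + β * 1 := by
          gcongr
          rw [div_le_one (by linarith)]
          linarith
      _ = n + β := by ring
  have e3 : s ≤ (k + 1) * s := le_mul_of_one_le_left hs0.le (by linarith)
  have e4 : (2 * p : ℝ) * (-β / (k + 1) + t / 2) =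
    (2 * p : ℝ) * (t / 2) - (2 * p : ℝ) * (β / (k + 1)) := by ring
  calc Real.exp (10 * (k + 1) * s - n)
      ≤ Real.exp ((2 * p : ℕ) * (-β / (k + 1) + t / 2)) := by
        rw [Real.exp_le_exp]
        push_cast
        rw [e4]
        linarith
    _ = (Real.exp (-β / (k + 1)) * Real.exp (t / 2)) ^ (2 * p) := by
        rw [← Real.exp_add, ← Real.exp_nat_mul]
    _ ≤ (Real.exp (-β / (k + 1)) * (1 + t)) ^ (2 * p) := by
        gcongr
        exact exp_half_le_one_add ht0 ht
    _ ≤ _ := by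
        gcongr
        rw [mul_add, mul_one]
        gcongr
        exact mul_le_of_le_one_left ht0 hle1

lemma four_mul_le_cube {k p : ℕ} {β n : ℝ} (hk : 1 ≤ k) (hβ : 0 < β) (hn : 1 < n)
    (hy : 4 / β + 4 ≤ k * n) (hp2 : 2 * p ≤ (k + 1) * n / β + 2) :
    2 * k * (2 * p) ≤ (k * n) ^ 3 := by
  have hkR : (1 : ℝ) ≤ k := by exact_mod_cast hk
  have h4β : 0 < 4 / β := by positivity
  have h1 : (2 * p : ℝ) ≤ (k + k) * n / β + 2 := hp2.trans (by gcongr)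
  have h4 : k * k * n ≤ (k * n) ^ 2 := by
    have : (k * n) ^ 2 = k * k * n * n := by ring
    rw [this]
    exact le_mul_of_one_le_right (by positivity) hn.le
  have h5 : (k : ℝ) ≤ k * k * n := by
    rw [mul_assoc]
    exact le_mul_of_one_le_right (by positivity) (one_le_mul_of_one_le_of_one_le hkR hn.le)
  calc (2 * k * (2 * p) : ℝ) ≤ 2 * k * ((k + k) * n / β + 2) := by gcongr
    _ = 4 / β * (k * k * n) + 4 * k := by ring
    _ ≤ 4 / β * (k * n) ^ 2 + 4 * (k * n) ^ 2 := by
        gcongr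
        linarith
    _ = (4 / β + 4) * (k * n) ^ 2 := by ring
    _ ≤ (k * n) * (k * n) ^ 2 := by gcongr
    _ = _ := by ring

/-- The choice of the even exponent `2 * p` in the moment method. -/
lemma exists_exponent {lam : ℝ} (h0 : 0 < lam) (h1 : lam < 1) :
    ∃ C : ℝ, 0 < C ∧ ∀ N k : ℕ, 3 ≤ N → 1 ≤ k →
      C * (Real.log k + Real.log (Real.log N)) / Real.log N < 2 →
      ∃ p : ℕ, 1 ≤ p ∧ ((k : ℝ) + 1) * Real.log N / Real.log (1 / lam) ≤ (2 * p : ℕ) ∧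
        4 * (2 * k * (2 * p)) ^ 2 ≤ N ∧
        k.factorial * (4 * (2 * (2 * k * (2 * p) : ℝ) ^ 2) ^ (k + 1) / N) +
          (N : ℝ) ^ k * (2 * (2 * p + 1) ^ 4 * lam ^ (2 * p)) ≤
          (lam ^ ((1 : ℝ) / ((k : ℝ) + 1)) +
            C * (Real.log k + Real.log (Real.log N)) / Real.log N) ^ (2 * p) := by
  have hβ0 : 0 < Real.log (1 / lam) := Real.log_pos (by rw [lt_div_iff₀ h0]; linarith)
  have hlamβ : lam = Real.exp (-Real.log (1 / lam)) := by
    rw [one_div, Real.log_inv, neg_neg, Real.exp_log h0]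
  generalize Real.log (1 / lam) = β at *
  have hlog3 : 1 < Real.log 3 := by
    rw [Real.lt_log_iff_exp_lt (by norm_num)]
    linarith [Real.exp_one_lt_d9]
  have hl₀ : 0 < Real.log (Real.log 3) := Real.log_pos hlog3
  have h4β : 0 < 4 / β := by positivity
  obtain ⟨Y, hY⟩ : ∃ Y, Y = 16 + (4 / β + 4) + Real.exp β := ⟨_, rfl⟩
  have hexpβ := Real.exp_pos β
  have hY0 : 0 < Y := by linarith
  obtain ⟨C, hC⟩ : ∃ C, C = 14 + 22 * β + 2 * Y / Real.log (Real.log 3) := ⟨_, rfl⟩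
  have hYl : 0 < 2 * Y / Real.log (Real.log 3) := by positivity
  have hC0 : 0 < C := by linarith
  refine ⟨C, hC0, fun N k hN hk hx => ?_⟩
  have hNR : (3 : ℝ) ≤ N := by exact_mod_cast hN
  have hN0 : (0 : ℝ) < N := by linarith
  have hkR : (1 : ℝ) ≤ k := by exact_mod_cast hk
  have hn3 : Real.log 3 ≤ Real.log N := Real.log_le_log (by norm_num) hNR
  have hexpn : Real.exp (Real.log N) = N := Real.exp_log hN0
  generalize Real.log N = n at *
  have hn1 : 1 < n := by linarith
  have hl : Real.log (Real.log 3) ≤ Real.log n := Real.log_le_log (by linarith) hn3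
  have hκ : 0 ≤ Real.log k := Real.log_nonneg hkR
  have hexps : Real.exp (Real.log k + Real.log n) = k * n := by
    rw [Real.exp_add, Real.exp_log (by linarith), Real.exp_log (by linarith)]
  have hsl : Real.log (Real.log 3) ≤ Real.log k + Real.log n := by linarith
  generalize Real.log k + Real.log n = s at *
  have hs0 : 0 < s := by linarith
  have hCs : C * s < 2 * n := by rwa [div_lt_iff₀ (by linarith)] at hx
  have hny : n ≤ k * n := le_mul_of_one_le_left (by linarith) hkR
  have hYy : Y ≤ k * n := by
    have h2 : 2 * Y = 2 * Y / Real.log (Real.log 3) * Real.log (Real.log 3) := by field_simp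
    have h3 : 2 * Y / Real.log (Real.log 3) * Real.log (Real.log 3) ≤ C * s :=
      mul_le_mul (by linarith) hsl hl₀.le hC0.le
    linarith
  have hβs : β ≤ s := by
    rw [← Real.exp_le_exp, hexps]
    linarith
  have hm0 : 0 < ((k : ℝ) + 1) * n / β := by positivity
  obtain ⟨p, hp, hpm, hpm2⟩ : ∃ p : ℕ, 1 ≤ p ∧ ((k : ℝ) + 1) * n / β ≤ 2 * p ∧
      (2 * p : ℝ) ≤ ((k : ℝ) + 1) * n / β + 2 := by
    refine ⟨⌈((k : ℝ) + 1) * n / β / 2⌉₊, Nat.one_le_ceil_iff.2 (by positivity), ?_, ?_⟩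
    · linarith [Nat.le_ceil (((k : ℝ) + 1) * n / β / 2)]
    · linarith [Nat.ceil_lt_add_one (a := ((k : ℝ) + 1) * n / β / 2) (by positivity)]
  have hKy := four_mul_le_cube hk hβ0 hn1 (by linarith) hpm2
  refine ⟨p, hp, by push_cast; exact hpm, ?_, ?_⟩
  · have h1 : (4 * (2 * k * (2 * p)) ^ 2 : ℝ) ≤ N := by
      calc (4 * (2 * k * (2 * p)) ^ 2 : ℝ) ≤ (k * n) * ((k * n) ^ 3) ^ 2 := by
            gcongr
            linarith
        _ = Real.exp s ^ 7 := by rw [hexps]; ring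
        _ = Real.exp (7 * s) := by rw [← Real.exp_nat_mul]; norm_num
        _ ≤ Real.exp n := by
            rw [Real.exp_le_exp]
            have : 14 * s ≤ C * s := by
              gcongr
              linarith
            linarith
        _ = N := hexpn
    exact_mod_cast h1
  · have hlamM : (N : ℝ) ^ k * lam ^ (2 * p) ≤ 1 / N := by
      have hmβ : (k + 1) * n ≤ 2 * p * β := by rwa [div_le_iff₀ hβ0] at hpm
      rw [le_div_iff₀ hN0, hlamβ, ← hexpn, ← Real.exp_nat_mul, ← Real.exp_nat_mul,
        ← Real.exp_add, ← Real.exp_add, Real.exp_le_one_iff]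
      push_cast
      linarith
    refine (moment_bound_le hN0 hk hp hlamM (by linarith) hKy).trans ?_
    have hroot : lam ^ ((1 : ℝ) / ((k : ℝ) + 1)) = Real.exp (-β / (k + 1)) := by
      rw [hlamβ, ← Real.exp_mul, mul_one_div]
    rw [hroot]
    refine le_trans (le_of_eq ?_)
      (exp_le_threshold_pow hk hβ0 (by linarith) hβs (by linarith) hx.le hpm hpm2)
    rw [Real.exp_sub, hexpn, ← hexps, ← pow_mul, ← Real.exp_nat_mul]
    push_cast
    rfl

lemma lamH_pos {D : ℕ} (hD : 4 ≤ D) : 0 < lamH D := by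
  have : (4 : ℝ) ≤ D := by exact_mod_cast hD
  have := Real.sqrt_pos.2 (by linarith : (0 : ℝ) < D - 1)
  rw [lamH]
  positivity

lemma lamH_lt_one {D : ℕ} (hD : 4 ≤ D) : lamH D < 1 := by
  have h : (4 : ℝ) ≤ D := by exact_mod_cast hD
  rw [lamH, div_lt_one (by linarith)]
  have := Real.sq_sqrt (by linarith : (0 : ℝ) ≤ D - 1)
  nlinarith [Real.sqrt_nonneg ((D : ℝ) - 1), sq_nonneg ((D : ℝ) - 2)]

end PermWalk

/-- Random permutations give classical k-copy tensor product expanders: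
for every even D ≥ 4 there is C > 0 such that for all N ≥ 3, k ≥ 1 and c > 1,
the probability (over uniform π₁,…,π_{D/2}, completed by inverses) that
‖L_k − Π_k‖ ≥ c(λ_H^{1/(k+1)} + C(log k + log log N)/log N) is at most
c^{−(k+1)·log N/log(1/λ_H)}. -/
theorem stmt3 (D : ℕ) (hD : 4 ≤ D) (hDeven : Even D) :
    ∃ C : ℝ, 0 < C ∧
      ∀ (N k : ℕ), 3 ≤ N → 1 ≤ k → ∀ c : ℝ, 1 < c →
        ((Nat.card {πs : Fin (D / 2) → Equiv.Perm (Fin N) //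
            c * (lamH D ^ ((1 : ℝ) / ((k : ℝ) + 1)) +
              C * (Real.log k + Real.log (Real.log N)) / Real.log N) ≤
            opNorm (LkHalf N D k πs - Pik N k)} : ℝ) /
          (Nat.card (Fin (D / 2) → Equiv.Perm (Fin N)) : ℝ)) ≤
        c ^ (-(((k : ℝ) + 1) * Real.log N / Real.log (1 / lamH D))) := by
  classical
  have hlam := PermWalk.lamH_pos hD
  obtain ⟨C, hC, hexp⟩ := PermWalk.exists_exponent hlam (PermWalk.lamH_lt_one hD)
  refine ⟨C, hC, fun N k hN hk c hc => ?_⟩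
  have hc0 : 0 < c := by linarith
  have hroot : 0 < lamH D ^ ((1 : ℝ) / ((k : ℝ) + 1)) := Real.rpow_pos_of_pos hlam _
  rcases le_or_gt 2 (C * (Real.log k + Real.log (Real.log N)) / Real.log N) with h2 | h2
  · have hempty : IsEmpty {πs : Fin (D / 2) → Equiv.Perm (Fin N) //
        c * (lamH D ^ ((1 : ℝ) / ((k : ℝ) + 1)) +
          C * (Real.log k + Real.log (Real.log N)) / Real.log N) ≤
          opNorm (LkHalf N D k πs - Pik N k)} := by
      refine ⟨fun ⟨π, hπ⟩ => ?_⟩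
      have := PermWalk.opNorm_sub_le (k := k) π (by omega) hDeven
      nlinarith
    rw [Nat.card_of_isEmpty, Nat.cast_zero, zero_div]
    positivity
  · obtain ⟨p, hp, hm, hK, hmom⟩ := hexp N k hN hk h2
    set A := lamH D ^ ((1 : ℝ) / ((k : ℝ) + 1)) +
      C * (Real.log k + Real.log (Real.log N)) / Real.log N with hA
    have hA0 : 0 < A := by
      have hN3 : (3 : ℝ) ≤ N := by exact_mod_cast hN
      have h1 : 1 ≤ Real.log N := by
        rw [Real.le_log_iff_exp_le (by linarith)]
        linarith [Real.exp_one_lt_d9]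
      have := Real.log_nonneg h1
      have := Real.log_natCast_nonneg k
      positivity
    have hsum := PermWalk.sum_opNorm_pow_le hD hDeven (by omega) hk hp hK
    rw [Nat.card_eq_fintype_card, Nat.card_eq_fintype_card, Fintype.card_subtype]
    set S := Finset.univ.filter fun π : Fin (D / 2) → Equiv.Perm (Fin N) =>
      c * A ≤ opNorm (LkHalf N D k π - Pik N k)
    have hmarkov : (S.card : ℝ) * (c * A) ^ (2 * p) ≤
        A ^ (2 * p) * Fintype.card (Fin (D / 2) → Equiv.Perm (Fin N)) := by
      calc (S.card : ℝ) * (c * A) ^ (2 * p) = ∑ _π ∈ S, (c * A) ^ (2 * p) := by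
            rw [Finset.sum_const, nsmul_eq_mul]
        _ ≤ ∑ π ∈ S, opNorm (LkHalf N D k π - Pik N k) ^ (2 * p) := by
            refine Finset.sum_le_sum fun π hπ => ?_
            have := (Finset.mem_filter.1 hπ).2
            gcongr
        _ ≤ ∑ π, opNorm (LkHalf N D k π - Pik N k) ^ (2 * p) :=
            Finset.sum_le_univ_sum_of_nonneg fun π => (even_two_mul p).pow_nonneg _
        _ ≤ _ := hsum.trans (mul_le_mul_of_nonneg_right hmom (Nat.cast_nonneg _))
    have hbound : (S.card : ℝ) / Fintype.card (Fin (D / 2) → Equiv.Perm (Fin N)) ≤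
        (c ^ (2 * p))⁻¹ := by
      have hcard : (0 : ℝ) < Fintype.card (Fin (D / 2) → Equiv.Perm (Fin N)) := by
        exact_mod_cast Fintype.card_pos
      rw [← one_div, div_le_div_iff₀ hcard (by positivity), one_mul]
      rw [mul_pow, ← mul_assoc, mul_comm (A ^ (2 * p))] at hmarkov
      exact le_of_mul_le_mul_right hmarkov (by positivity)
    refine hbound.trans ?_
    rw [← Real.rpow_natCast, ← Real.rpow_neg hc0.le]
    exact Real.rpow_le_rpow_of_exponent_le hc.le (neg_le_neg hm)

end
end
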